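/- Let X and Y be normal color Hopf subalgebras of a cocommutative color Hopf algebra A (normal meaning closed under the adjoint action a ▷ x = φ(|a₂|,|x|) a₁ x S(a₂) for all a ∈ A). Define [x,y] := φ(|x₂|,|y₁|) x₁ y₁ S(x₂) S(y₂). Then the graded subalgebra [X,Y] of A generated by all elements [x,y] with x ∈ X, y ∈ Y is a graded subcoalgebra of A; explicitly, Δ([x,y]) = φ(|x₂|,|y₁|) [x₁,y₁] ⊗ [x₂,y₂]. -/

import Mathlib

open TensorProduct

namespace ColorHopfPaper

variable (k : Type*) [Field k] (G : Type*) [CommGroup G]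

/-- The "middle interchange" map `(A⊗A)⊗(B⊗B) → (A⊗B)⊗(A⊗B)` built from a braiding
`c : A⊗B → B⊗A` applied to the two middle factors. -/
noncomputable def midMap {A B : Type*} [AddCommGroup A] [Module k A]
    [AddCommGroup B] [Module k B] (c : A ⊗[k] B →ₗ[k] B ⊗[k] A) :
    (A ⊗[k] A) ⊗[k] (B ⊗[k] B) →ₗ[k] (A ⊗[k] B) ⊗[k] (A ⊗[k] B) :=
  (TensorProduct.assoc k A B (A ⊗[k] B)).symm.toLinearMap ∘ₗ
    (TensorProduct.map LinearMap.id
      ((TensorProduct.assoc k B A B).toLinearMap ∘ₗ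
        (TensorProduct.map c LinearMap.id) ∘ₗ
        (TensorProduct.assoc k A B B).symm.toLinearMap)) ∘ₗ
    (TensorProduct.assoc k A A (B ⊗[k] B)).toLinearMap


/-- Generic Hopf kernel `{x : x₁ ⊗ f(x₂) = x ⊗ 1}` of `f`, for a comultiplication `Δ`. -/
noncomputable def hkerGen {X B : Type*} [AddCommGroup X] [Module k X]
    [AddCommGroup B] [Module k B]
    (Δ : X →ₗ[k] X ⊗[k] X) (f : X →ₗ[k] B) (oneB : B) : Submodule k X :=
  LinearMap.ker (((TensorProduct.map LinearMap.id f) ∘ₗ Δ) -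
    (TensorProduct.mk k X B).flip oneB)

/-- A (cocommutative) color Hopf algebra: a cocommutative Hopf monoid in the symmetric
monoidal category of `G`-graded `k`-vector spaces, with braiding given by a
skew-symmetric bicharacter `φ`. -/
structure ColorHopfAlg (H : Type*) [AddCommGroup H] [Module k H] where
  φ : G → G → k
  φ_ne : ∀ g h : G, φ g h ≠ 0
  φ_mul_left : ∀ g h l : G, φ (g * h) l = φ g l * φ h l
  φ_mul_right : ∀ g h l : G, φ g (h * l) = φ g h * φ g l
  φ_skew : ∀ g h : G, φ g h * φ h g = 1
  grade : G → Submodule k H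
  grade_top : ⨆ g : G, grade g = ⊤
  mul : H ⊗[k] H →ₗ[k] H
  one : H
  comul : H →ₗ[k] H ⊗[k] H
  counit : H →ₗ[k] k
  antipode : H →ₗ[k] H
  braid : H ⊗[k] H →ₗ[k] H ⊗[k] H
  braid_apply : ∀ (g h : G) (x y : H), x ∈ grade g → y ∈ grade h →
    braid (x ⊗ₜ[k] y) = φ g h • (y ⊗ₜ[k] x)
  one_mem : one ∈ grade 1
  mul_mem : ∀ (g h : G) (x y : H), x ∈ grade g → y ∈ grade h →
    mul (x ⊗ₜ[k] y) ∈ grade (g * h)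
  antipode_mem : ∀ (g : G) (x : H), x ∈ grade g → antipode x ∈ grade g
  mul_assoc' : ∀ x y z : H,
    mul (mul (x ⊗ₜ[k] y) ⊗ₜ[k] z) = mul (x ⊗ₜ[k] mul (y ⊗ₜ[k] z))
  one_mul' : ∀ x : H, mul (one ⊗ₜ[k] x) = x
  mul_one' : ∀ x : H, mul (x ⊗ₜ[k] one) = x
  coassoc : (TensorProduct.assoc k H H H).toLinearMap ∘ₗ
      (TensorProduct.map comul LinearMap.id) ∘ₗ comul
      = (TensorProduct.map LinearMap.id comul) ∘ₗ comul
  counit_left : ∀ x : H,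
    (TensorProduct.lid k H) ((TensorProduct.map counit LinearMap.id) (comul x)) = x
  counit_right : ∀ x : H,
    (TensorProduct.rid k H) ((TensorProduct.map LinearMap.id counit) (comul x)) = x
  comul_one : comul one = one ⊗ₜ[k] one
  counit_one : counit one = 1
  counit_mul : ∀ x y : H, counit (mul (x ⊗ₜ[k] y)) = counit x * counit y
  comul_mul : comul ∘ₗ mul =
    (TensorProduct.map mul mul) ∘ₗ midMap k braid ∘ₗ (TensorProduct.map comul comul)
  cocomm : braid ∘ₗ comul = comul
  antipode_left : ∀ x : H,
    mul ((TensorProduct.map antipode LinearMap.id) (comul x)) = counit x • one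
  antipode_right : ∀ x : H,
    mul ((TensorProduct.map LinearMap.id antipode) (comul x)) = counit x • one

namespace ColorHopfAlg

variable {k G}
variable {H : Type*} [AddCommGroup H] [Module k H] (C : ColorHopfAlg k G H)

/-- An element is homogeneous if it lies in one of the graded components. -/
def homogeneous (x : H) : Prop := ∃ g : G, x ∈ C.grade g

/-- The (color) adjoint action `ξ(a ⊗ b) = φ(|a₂|,|b|) a₁ b S(a₂)`. -/
noncomputable def adj : H ⊗[k] H →ₗ[k] H :=
  C.mul ∘ₗ
    (TensorProduct.map LinearMap.id
      (C.mul ∘ₗ (TensorProduct.map LinearMap.id C.antipode) ∘ₗ C.braid)) ∘ₗ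
    (TensorProduct.assoc k H H H).toLinearMap ∘ₗ
    (TensorProduct.map C.comul LinearMap.id)

/-- The commutator `[x,y] = φ(|x₂|,|y₁|) x₁y₁S(x₂)S(y₂) = (x ▷ y₁) S(y₂)`. -/
noncomputable def commMap : H ⊗[k] H →ₗ[k] H :=
  C.mul ∘ₗ (TensorProduct.map C.adj C.antipode) ∘ₗ
    (TensorProduct.assoc k H H H).symm.toLinearMap ∘ₗ
    (TensorProduct.map LinearMap.id C.comul)

/-- The comultiplication of the tensor-product (product) coalgebra `H ⊗ H`:
`x ⊗ y ↦ φ(|x₂|,|y₁|) (x₁⊗y₁)⊗(x₂⊗y₂)`. -/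
noncomputable def comul2 : H ⊗[k] H →ₗ[k] (H ⊗[k] H) ⊗[k] (H ⊗[k] H) :=
  midMap k C.braid ∘ₗ TensorProduct.map C.comul C.comul

/-- The counit of the tensor-product coalgebra `H ⊗ H`. -/
noncomputable def counit2 : H ⊗[k] H →ₗ[k] k :=
  (TensorProduct.lid k k).toLinearMap ∘ₗ TensorProduct.map C.counit C.counit

/-- `V` is a (graded) color Hopf subalgebra of `H`. -/
structure IsCHSub (V : Submodule k H) : Prop where
  one_mem : C.one ∈ V
  mul_mem : ∀ x ∈ V, ∀ y ∈ V, C.mul (x ⊗ₜ[k] y) ∈ V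
  comul_mem : ∀ x ∈ V,
    C.comul x ∈ LinearMap.range (TensorProduct.map V.subtype V.subtype)
  antipode_mem : ∀ x ∈ V, C.antipode x ∈ V
  graded : ∀ x ∈ V, x ∈ Submodule.span k {y : H | y ∈ V ∧ ∃ g : G, y ∈ C.grade g}

/-- `V` is normal: closed under the adjoint action of all of `H`. -/
def IsNormal (V : Submodule k H) : Prop :=
  ∀ a : H, ∀ x ∈ V, C.adj (a ⊗ₜ[k] x) ∈ V

/-- The subalgebra (as a submodule) generated by a set. -/
def genFrom (Sgen : Set H) : Submodule k H :=
  sInf {V : Submodule k H |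
    Sgen ⊆ ↑V ∧ C.one ∈ V ∧ ∀ x ∈ V, ∀ y ∈ V, C.mul (x ⊗ₜ[k] y) ∈ V}

/-- The commutator subalgebra `[X,Y]`, generated by all `[x,y]` with `x ∈ V`, `y ∈ W`. -/
def commSub (V W : Submodule k H) : Submodule k H :=
  C.genFrom {z : H | ∃ x ∈ V, ∃ y ∈ W, z = C.commMap (x ⊗ₜ[k] y)}

/-- The graded subspace `VW` spanned by products `vw`. -/
def prodSpan (V W : Submodule k H) : Submodule k H :=
  Submodule.span k {z : H | ∃ x ∈ V, ∃ y ∈ W, z = C.mul (x ⊗ₜ[k] y)}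

/-- The Hopf kernel `Hker(f) = {x : x₁ ⊗ f(x₂) = x ⊗ 1}` of a map `f : H → B`. -/
noncomputable def hkerOf {B : Type*} [AddCommGroup B] [Module k B]
    (CB : ColorHopfAlg k G B) (f : H →ₗ[k] B) : Submodule k H :=
  LinearMap.ker
    (((TensorProduct.map LinearMap.id f) ∘ₗ C.comul) -
      (TensorProduct.mk k H B).flip CB.one)

end ColorHopfAlg

/-- A morphism of color Hopf algebras. -/
structure IsColorHom {A B : Type*} [AddCommGroup A] [Module k A]
    [AddCommGroup B] [Module k B]
    (CA : ColorHopfAlg k G A) (CB : ColorHopfAlg k G B) (f : A →ₗ[k] B) : Prop where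
  map_mul : ∀ x y : A, f (CA.mul (x ⊗ₜ[k] y)) = CB.mul (f x ⊗ₜ[k] f y)
  map_one : f CA.one = CB.one
  map_comul : CB.comul ∘ₗ f = (TensorProduct.map f f) ∘ₗ CA.comul
  map_counit : CB.counit ∘ₗ f = CA.counit
  map_grade : ∀ g : G, ∀ x ∈ CA.grade g, f x ∈ CB.grade g

/-- A color Hopf crossed module `(A, H, d)`. -/
structure ColorCrossedMod {A H : Type*} [AddCommGroup A] [Module k A]
    [AddCommGroup H] [Module k H]
    (CA : ColorHopfAlg k G A) (CH : ColorHopfAlg k G H) where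
  cAH : A ⊗[k] H →ₗ[k] H ⊗[k] A
  cHA : H ⊗[k] A →ₗ[k] A ⊗[k] H
  cAH_apply : ∀ (g h : G) (a : A) (x : H), a ∈ CA.grade g → x ∈ CH.grade h →
    cAH (a ⊗ₜ[k] x) = CA.φ g h • (x ⊗ₜ[k] a)
  cHA_apply : ∀ (g h : G) (x : H) (a : A), x ∈ CH.grade g → a ∈ CA.grade h →
    cHA (x ⊗ₜ[k] a) = CH.φ g h • (a ⊗ₜ[k] x)
  φ_eq : CH.φ = CA.φ
  act : A ⊗[k] H →ₗ[k] H
  act_one_left : ∀ x : H, act (CA.one ⊗ₜ[k] x) = x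
  act_act : ∀ (a b : A) (x : H),
    act (a ⊗ₜ[k] act (b ⊗ₜ[k] x)) = act (CA.mul (a ⊗ₜ[k] b) ⊗ₜ[k] x)
  act_one : ∀ a : A, act (a ⊗ₜ[k] CH.one) = CA.counit a • CH.one
  counit_act : ∀ (a : A) (x : H),
    CH.counit (act (a ⊗ₜ[k] x)) = CA.counit a * CH.counit x
  comul_act : CH.comul ∘ₗ act =
    (TensorProduct.map act act) ∘ₗ midMap k cAH ∘ₗ
      (TensorProduct.map CA.comul CH.comul)
  act_mul : act ∘ₗ (TensorProduct.map LinearMap.id CH.mul) =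
    CH.mul ∘ₗ (TensorProduct.map act act) ∘ₗ midMap k cAH ∘ₗ
      (TensorProduct.map CA.comul LinearMap.id)
  act_grade : ∀ (g h : G) (a : A) (x : H), a ∈ CA.grade g → x ∈ CH.grade h →
    act (a ⊗ₜ[k] x) ∈ CH.grade (g * h)
  d : H →ₗ[k] A
  d_hom : IsColorHom k G CH CA d
  peiffer₁ : d ∘ₗ act = CA.adj ∘ₗ (TensorProduct.map LinearMap.id d)
  peiffer₂ : act ∘ₗ (TensorProduct.map d LinearMap.id) = CH.adj

namespace ColorCrossedMod

variable {k G}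
variable {A H : Type*} [AddCommGroup A] [Module k A] [AddCommGroup H] [Module k H]
variable {CA : ColorHopfAlg k G A} {CH : ColorHopfAlg k G H}

/-- The multiplication of the semi-direct (smash) product `H ⋊ A`:
`(h⊗a)(h'⊗a') = φ(|a₂|,|h'|) h (a₁·h') ⊗ a₂a'`. -/
noncomputable def smashMul (M : ColorCrossedMod k G CA CH) : (H ⊗[k] A) ⊗[k] (H ⊗[k] A) →ₗ[k] H ⊗[k] A :=
  (TensorProduct.map CH.mul CA.mul) ∘ₗ
  (TensorProduct.assoc k (H ⊗[k] H) A A).toLinearMap ∘ₗ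
  (TensorProduct.map (TensorProduct.assoc k H H A).symm.toLinearMap LinearMap.id) ∘ₗ
  (TensorProduct.map
    (TensorProduct.map LinearMap.id (TensorProduct.map M.act LinearMap.id))
    LinearMap.id) ∘ₗ
  (TensorProduct.map
    ((TensorProduct.map LinearMap.id
        ((TensorProduct.assoc k A H A).symm.toLinearMap ∘ₗ
          (TensorProduct.map LinearMap.id M.cAH) ∘ₗ
          (TensorProduct.assoc k A A H).toLinearMap)) ∘ₗ
      (TensorProduct.assoc k H (A ⊗[k] A) H).toLinearMap)
    LinearMap.id) ∘ₗ
  (TensorProduct.assoc k (H ⊗[k] (A ⊗[k] A)) H A).symm.toLinearMap ∘ₗ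
  (TensorProduct.map (TensorProduct.map LinearMap.id CA.comul) LinearMap.id)

/-- The comultiplication of `H ⋊ A` (tensor-product coalgebra twisted by `φ`). -/
noncomputable def smashComul (M : ColorCrossedMod k G CA CH) : H ⊗[k] A →ₗ[k] (H ⊗[k] A) ⊗[k] (H ⊗[k] A) :=
  midMap k M.cHA ∘ₗ TensorProduct.map CH.comul CA.comul

/-- The counit of `H ⋊ A`. -/
noncomputable def smashCounit (_M : ColorCrossedMod k G CA CH) : H ⊗[k] A →ₗ[k] k :=
  (TensorProduct.lid k k).toLinearMap ∘ₗ TensorProduct.map CH.counit CA.counit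

end ColorCrossedMod


section Abstract

/-- Diagonal operator. -/
noncomputable def dgOf {k ι A : Type*} [Field k] [Ring A] [Algebra k A]
    (e : Module.Basis ι k A) (τ : ι → k) : A →ₗ[k] A :=
  e.constr k (fun i => τ i • e i)

/-- Sweedler sum in terms of a basis. -/
noncomputable def swOf {k ι A M : Type*} [Field k] [Ring A] [Algebra k A]
    [AddCommGroup M] [Module k M]
    (e : Module.Basis ι k A) (Δ : A →ₗ[k] A ⊗[k] A) (i : ι) (f : ι → ι → M) : M :=
  ((e.tensorProduct e).repr (Δ (e i))).sum fun p c => c • f p.1 p.2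

/-- A diagonal operator compatible with the algebra structure. -/
structure IsCharOf {k ι A : Type*} [Field k] [Ring A] [Algebra k A]
    (e : Module.Basis ι k A) (S : A →ₗ[k] A) (τ : ι → k) : Prop where
  ne : ∀ i, τ i ≠ 0
  mul : ∀ x y, dgOf e τ (x * y) = dgOf e τ x * dgOf e τ y
  anti : ∀ x, dgOf e τ (S x) = S (dgOf e τ x)
  one : dgOf e τ 1 = 1

/-- Index form of a cocommutative color Hopf algebra. -/
structure HD (k ι A : Type*) [Field k] [Ring A] [Algebra k A] where
  e : Module.Basis ι k A
  Δ : A →ₗ[k] A ⊗[k] A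
  ε : A →ₗ[k] k
  S : A →ₗ[k] A
  χ : ι → ι → k
  χ_swap : ∀ i j, χ i j * χ j i = 1
  chL : ∀ m, IsCharOf e S (fun i => χ i m)
  chR : ∀ m, IsCharOf e S (fun i => χ m i)
  coassoc : (TensorProduct.assoc k A A A).toLinearMap ∘ₗ
      (TensorProduct.map Δ LinearMap.id) ∘ₗ Δ
      = (TensorProduct.map LinearMap.id Δ) ∘ₗ Δ
  counit_left : ∀ x : A,
    (TensorProduct.lid k A) ((TensorProduct.map ε LinearMap.id) (Δ x)) = x
  counit_right : ∀ x : A,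
    (TensorProduct.rid k A) ((TensorProduct.map LinearMap.id ε) (Δ x)) = x
  comul_one : Δ 1 = 1 ⊗ₜ[k] 1
  counit_one : ε 1 = 1
  counit_mul : ∀ x y, ε (x * y) = ε x * ε y
  comul_mul : ∀ i j, Δ (e i * e j) = swOf e Δ i fun a b => swOf e Δ j fun p q =>
    χ b p • ((e a * e p) ⊗ₜ[k] (e b * e q))
  cocomm : ∀ i, swOf e Δ i (fun a b => χ a b • (e b ⊗ₜ[k] e a)) = Δ (e i)
  antipode_left : ∀ x, LinearMap.mul' k A ((TensorProduct.map S LinearMap.id) (Δ x)) = ε x • 1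
  antipode_right : ∀ x, LinearMap.mul' k A ((TensorProduct.map LinearMap.id S) (Δ x)) = ε x • 1

namespace HD

variable {k ι A : Type*} [Field k] [Ring A] [Algebra k A] (h : HD k ι A)
variable {M N : Type*} [AddCommGroup M] [Module k M] [AddCommGroup N] [Module k N]

noncomputable def dg (τ : ι → k) : A →ₗ[k] A := dgOf h.e τ

noncomputable def Sw (i : ι) (f : ι → ι → M) : M := swOf h.e h.Δ i f

def IsChar (τ : ι → k) : Prop := IsCharOf h.e h.S τ

noncomputable def ep (i : ι) : k := h.ε (h.e i)

@[simp] lemma dg_e (τ : ι → k) (i : ι) : h.dg τ (h.e i) = τ i • h.e i := by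
  simp [dg, dgOf]

lemma Sw_map (L : M →ₗ[k] N) (i : ι) (f : ι → ι → M) :
    L (h.Sw i f) = h.Sw i fun a b => L (f a b) := by
  simp [Sw, swOf, Finsupp.sum]

lemma Sw_mapE (L : M ≃ₗ[k] N) (i : ι) (f : ι → ι → M) :
    L (h.Sw i f) = h.Sw i fun a b => L (f a b) :=
  h.Sw_map L.toLinearMap i f

lemma Sw_smul (c : k) (i : ι) (f : ι → ι → M) :
    c • (h.Sw i f) = h.Sw i fun a b => c • (f a b) :=
  h.Sw_map (LinearMap.lsmul k M c) i f

lemma Sw_add (i : ι) (f g : ι → ι → M) :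
    h.Sw i (fun a b => f a b + g a b) = h.Sw i f + h.Sw i g := by
  simp [Sw, swOf, Finsupp.sum, Finset.sum_add_distrib]

lemma Sw_apply (i : ι) (f : ι → ι → (N →ₗ[k] M)) (x : N) :
    (h.Sw i f) x = h.Sw i fun a b => f a b x :=
  h.Sw_map (LinearMap.applyₗ x) i f

lemma Sw_mulL (x : A) (i : ι) (f : ι → ι → A) :
    x * (h.Sw i f) = h.Sw i fun a b => x * (f a b) :=
  h.Sw_map (LinearMap.mulLeft k x) i f

lemma Sw_mulR (x : A) (i : ι) (f : ι → ι → A) :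
    (h.Sw i f) * x = h.Sw i fun a b => (f a b) * x :=
  h.Sw_map (LinearMap.mulRight k x) i f

lemma Sw_tmulR (x : N) (i : ι) (f : ι → ι → M) :
    (h.Sw i f) ⊗ₜ[k] x = h.Sw i fun a b => (f a b) ⊗ₜ[k] x :=
  h.Sw_map ((TensorProduct.mk k M N).flip x) i f

lemma Sw_tmulL (x : N) (i : ι) (f : ι → ι → M) :
    x ⊗ₜ[k] (h.Sw i f) = h.Sw i fun a b => x ⊗ₜ[k] (f a b) :=
  h.Sw_map ((TensorProduct.mk k N M) x) i f

lemma Sw_comm (i j : ι) (f : ι → ι → ι → ι → M) :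
    (h.Sw i fun a b => h.Sw j fun p q => f a b p q) =
      h.Sw j fun p q => h.Sw i fun a b => f a b p q := by
  simp only [Sw, swOf, Finsupp.sum, Finset.smul_sum]
  rw [Finset.sum_comm]
  exact Finset.sum_congr rfl fun x _ => Finset.sum_congr rfl fun y _ => smul_comm _ _ _

lemma Sw_Δ (L : A ⊗[k] A →ₗ[k] M) (i : ι) :
    L (h.Δ (h.e i)) = h.Sw i fun a b => L (h.e a ⊗ₜ h.e b) := by
  conv_lhs => rw [← (h.e.tensorProduct h.e).linearCombination_repr (h.Δ (h.e i))]
  simp [Sw, swOf, Finsupp.linearCombination_apply, Finsupp.sum,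
    Module.Basis.tensorProduct_apply']

lemma Δ_e (i : ι) : h.Δ (h.e i) = h.Sw i fun a b => (h.e a ⊗ₜ[k] h.e b) :=
  h.Sw_Δ LinearMap.id i

/-- the linear map on `A ⊗ A` with given values -/
noncomputable def L2 (f : ι → ι → M) : A ⊗[k] A →ₗ[k] M :=
  (h.e.tensorProduct h.e).constr k fun p => f p.1 p.2

@[simp] lemma L2_e (f : ι → ι → M) (a b : ι) : h.L2 f (h.e a ⊗ₜ h.e b) = f a b := by
  rw [← Module.Basis.tensorProduct_apply, L2, Module.Basis.constr_basis]

noncomputable def L3 (f : ι → ι → ι → M) : A ⊗[k] (A ⊗[k] A) →ₗ[k] M :=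
  (h.e.tensorProduct (h.e.tensorProduct h.e)).constr k fun p => f p.1 p.2.1 p.2.2

@[simp] lemma L3_e (f : ι → ι → ι → M) (a b c : ι) :
    h.L3 f (h.e a ⊗ₜ (h.e b ⊗ₜ h.e c)) = f a b c := by
  rw [← Module.Basis.tensorProduct_apply h.e h.e, ← Module.Basis.tensorProduct_apply, L3,
    Module.Basis.constr_basis]

lemma coas (i : ι) (f : ι → ι → ι → M) :
    (h.Sw i fun t c => h.Sw t fun a b => f a b c) =
      h.Sw i fun a t => h.Sw t fun b c => f a b c := by
  have := congrArg (h.L3 f) (LinearMap.congr_fun h.coassoc (h.e i))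
  simpa [Δ_e, Sw_map, Sw_mapE, Sw_tmulR, Sw_tmulL] using this

lemma coco (i : ι) (f : ι → ι → M) :
    (h.Sw i fun a b => h.χ a b • f b a) = h.Sw i f := by
  have := congrArg (h.L2 f) (h.cocomm i)
  rw [Sw_Δ] at this
  change h.L2 f (h.Sw i _) = _ at this
  simpa [Sw_map] using this

lemma couL (i : ι) (f : ι → M) : (h.Sw i fun a b => h.ep a • f b) = f i := by
  have := congrArg (h.e.constr k f) (h.counit_left (h.e i))
  simpa [Δ_e, Sw_map, Sw_mapE, ep] using this

lemma couR (i : ι) (f : ι → M) : (h.Sw i fun a b => h.ep b • f a) = f i := by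
  have := congrArg (h.e.constr k f) (h.counit_right (h.e i))
  simpa [Δ_e, Sw_map, Sw_mapE, ep] using this

lemma antL (i : ι) : (h.Sw i fun a b => h.S (h.e a) * h.e b) = h.ep i • 1 := by
  have := h.antipode_left (h.e i)
  simpa [Δ_e, Sw_map, Sw_mapE, ep] using this

lemma antR (i : ι) : (h.Sw i fun a b => h.e a * h.S (h.e b)) = h.ep i • 1 := by
  have := h.antipode_right (h.e i)
  simpa [Δ_e, Sw_map, Sw_mapE, ep] using this

lemma Δmul (i j : ι) : h.Δ (h.e i * h.e j) = h.Sw i fun a b => h.Sw j fun p q =>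
    h.χ b p • ((h.e a * h.e p) ⊗ₜ[k] (h.e b * h.e q)) := h.comul_mul i j

variable {h} in
lemma IsChar.mulc {τ σ : ι → k} (ht : h.IsChar τ) (hs : h.IsChar σ) :
    h.IsChar (fun i => τ i * σ i) := by
  have key : dgOf h.e (fun i => τ i * σ i) = dgOf h.e τ ∘ₗ dgOf h.e σ := by
    apply h.e.ext; intro i
    simp [dgOf, smul_smul, mul_comm]
  constructor
  · intro i; exact mul_ne_zero (ht.ne i) (hs.ne i)
  · intro x y; simp [key, ht.mul, hs.mul]
  · intro x; simp [key, ht.anti, hs.anti]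
  · simp [key, ht.one, hs.one]

lemma IsChar.onec : h.IsChar (fun _ => 1) := by
  have key : dgOf h.e (fun _ => 1) = LinearMap.id := by
    apply h.e.ext; intro i
    simp [dgOf]
  constructor <;> simp [key]

variable {h} in
lemma IsChar.antS {τ : ι → k} (ht : h.IsChar τ) (i : ι) :
    h.dg τ (h.S (h.e i)) = τ i • h.S (h.e i) := by
  rw [dg, ht.anti]; simp [dgOf]

variable {h} in
lemma IsChar.dmul {τ : ι → k} (ht : h.IsChar τ) (x y : A) :
    h.dg τ (x * y) = h.dg τ x * h.dg τ y := ht.mul x y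

lemma twL {τ : ι → k} (ht : h.IsChar τ) (i : ι) :
    (h.Sw i fun a b => (τ a * τ b) • (h.S (h.e a) * h.e b)) = h.ep i • 1 := by
  have := congrArg (h.dg τ) (h.antL i)
  rw [Sw_map, map_smul, show h.dg τ 1 = 1 from ht.one] at this
  rw [← this]
  simp [ht.dmul, ht.antS, smul_smul, mul_comm]

lemma twR {τ : ι → k} (ht : h.IsChar τ) (i : ι) :
    (h.Sw i fun a b => (τ a * τ b) • (h.e a * h.S (h.e b))) = h.ep i • 1 := by
  have := congrArg (h.dg τ) (h.antR i)
  rw [Sw_map, map_smul, show h.dg τ 1 = 1 from ht.one] at this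
  rw [← this]
  simp [ht.dmul, ht.antS, smul_smul, mul_comm]

lemma χne (i j : ι) : h.χ i j ≠ 0 := left_ne_zero_of_mul_eq_one (h.χ_swap i j)

lemma cL (m : ι) : h.IsChar (fun i => h.χ i m) := h.chL m
lemma cR (m : ι) : h.IsChar (fun i => h.χ m i) := h.chR m

lemma Sw_congr {i : ι} {f g : ι → ι → M} (H : ∀ a b, f a b = g a b) : h.Sw i f = h.Sw i g := by
  congr; funext a b; exact H a b

lemma inR_eS (t : ι) {τ : ι → k} (hτ : h.IsChar τ) (f : A →ₗ[k] M) :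
    (h.Sw t fun b c => (τ b * τ c) • f (h.e b * h.S (h.e c))) = h.ep t • f 1 := by
  have := congrArg f (h.twR hτ t)
  simpa [Sw_map] using this

lemma inL_Se (t : ι) {τ : ι → k} (hτ : h.IsChar τ) (f : A →ₗ[k] M) :
    (h.Sw t fun b c => (τ b * τ c) • f (h.S (h.e b) * h.e c)) = h.ep t • f 1 := by
  have := congrArg f (h.twL hτ t)
  simpa [Sw_map] using this

lemma dropR_eS (i : ι) (τ : ι → ι → k) (hτ : ∀ a, h.IsChar (τ a)) (f : ι → A →ₗ[k] M) :
    (h.Sw i fun a t => h.Sw t fun b c => (τ a b * τ a c) • f a (h.e b * h.S (h.e c))) =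
      f i 1 := by
  rw [← h.couR i (fun a => f a 1)]
  exact h.Sw_congr fun a t => h.inR_eS t (hτ a) _

lemma dropR_Se (i : ι) (τ : ι → ι → k) (hτ : ∀ a, h.IsChar (τ a)) (f : ι → A →ₗ[k] M) :
    (h.Sw i fun a t => h.Sw t fun b c => (τ a b * τ a c) • f a (h.S (h.e b) * h.e c)) =
      f i 1 := by
  rw [← h.couR i (fun a => f a 1)]
  exact h.Sw_congr fun a t => h.inL_Se t (hτ a) _

lemma dropL_eS (i : ι) (τ : ι → ι → k) (hτ : ∀ a, h.IsChar (τ a)) (f : ι → A →ₗ[k] M) :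
    (h.Sw i fun t c => h.Sw t fun a b => (τ c a * τ c b) • f c (h.e a * h.S (h.e b))) =
      f i 1 := by
  rw [← h.couL i (fun a => f a 1)]
  exact h.Sw_congr fun t c => h.inR_eS t (hτ c) _

lemma dropL_Se (i : ι) (τ : ι → ι → k) (hτ : ∀ a, h.IsChar (τ a)) (f : ι → A →ₗ[k] M) :
    (h.Sw i fun t c => h.Sw t fun a b => (τ c a * τ c b) • f c (h.S (h.e a) * h.e b)) =
      f i 1 := by
  rw [← h.couL i (fun a => f a 1)]
  exact h.Sw_congr fun t c => h.inL_Se t (hτ c) _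

lemma ep_χ (i j : ι) : h.ep i * h.χ i j = h.ep i := by
  have h1 : ∀ i, h.e i * h.e j = h.Sw i fun a b => (h.χ b j * h.ep b) • (h.e a * h.e j) := by
    intro i
    have := h.counit_right (h.e i * h.e j)
    rw [Δmul] at this
    simp only [Sw_map, Sw_mapE, map_smul, TensorProduct.map_tmul, LinearMap.id_apply,
      TensorProduct.rid_tmul, counit_mul] at this
    rw [← this]
    refine h.Sw_congr fun a b => ?_
    rw [← h.couR j (fun p => (h.χ b p * h.ep b) • (h.e a * h.e p))]
    refine h.Sw_congr fun p q => ?_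
    simp only [smul_smul, ep]; congr 1; ring
  have h2 : (h.Sw i fun s t => h.S (h.e s) * (h.e t * h.e j)) = h.ep i • h.e j := by
    have := h.inL_Se i (IsChar.onec h) (LinearMap.mulRight k (h.e j))
    simpa [mul_assoc] using this
  have h3 : (h.Sw i fun s t => h.S (h.e s) * (h.e t * h.e j)) = (h.χ i j * h.ep i) • h.e j := by
    have E : ∀ s t, h.S (h.e s) * (h.e t * h.e j) = h.Sw t fun a b =>
        h.S (h.e s) * ((h.χ b j * h.ep b) • (h.e a * h.e j)) := by
      intro s t
      conv_lhs => rw [h1 t]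
      rw [Sw_mulL]
    rw [h.Sw_congr E]
    rw [← h.coas i (fun s a b => h.S (h.e s) * ((h.χ b j * h.ep b) • (h.e a * h.e j)))]
    have := h.dropL_Se i (fun _ _ => 1) (fun _ => IsChar.onec h)
      (fun b => (h.χ b j * h.ep b) • LinearMap.mulRight k (h.e j))
    simpa [mul_assoc] using this
  rw [h2] at h3
  have := sub_eq_zero.2 h3
  rw [← sub_smul, smul_eq_zero] at this
  rcases this with h4 | h4
  · linear_combination -h4
  · exact absurd h4 (h.e.ne_zero j)

lemma ep_χ' (i j : ι) : h.ep i * h.χ j i = h.ep i := by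
  have := h.ep_χ i j
  have h2 := h.χ_swap i j
  linear_combination (-h.χ j i) * this + h.ep i * h2

lemma S_mul (i j : ι) : h.S (h.e i * h.e j) = h.χ i j • (h.S (h.e j) * h.S (h.e i)) := by
  have A1 : ∀ i j, (h.Sw i fun a b => h.Sw j fun p q =>
      h.χ b p • (h.S (h.e a * h.e p) * (h.e b * h.e q))) = (h.ep i * h.ep j) • (1 : A) := by
    intro i j
    have := h.antipode_left (h.e i * h.e j)
    rw [Δmul] at this
    simpa [Sw_map, counit_mul, ep] using this
  have A2 : ∀ i j, (h.Sw i fun a b => h.χ b j • (h.S (h.e a * h.e j) * h.e b)) =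
      h.ep i • h.S (h.e j) := by
    intro i j
    have := h.couL j (fun r => h.ep i • h.S (h.e r))
    rw [← this]
    have E : ∀ j' r, h.ep j' • h.ep i • h.S (h.e r) = ((h.ep i * h.ep j') • (1:A)) * h.S (h.e r) := by
      intro j' r; simp [smul_smul, mul_comm]
    simp only [E, ← A1, Sw_mulR]
    simp only [h.Sw_comm _ i]
    refine h.Sw_congr fun a b => ?_
    rw [h.coas j (fun p q r => h.χ b p • (h.S (h.e a * h.e p) * (h.e b * h.e q)) * h.S (h.e r))]
    have := h.dropR_eS j (fun _ _ => 1) (fun _ => IsChar.onec h)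
      (fun p => h.χ b p • LinearMap.mulLeft k (h.S (h.e a * h.e p) * h.e b))
    simpa [mul_assoc] using this.symm
  have := h.couL i (fun r => h.χ r j • (h.S (h.e j) * h.S (h.e r)))
  rw [← this]
  have E : ∀ i' r, h.ep i' • h.χ r j • (h.S (h.e j) * h.S (h.e r)) =
      h.χ r j • ((h.ep i' • h.S (h.e j)) * h.S (h.e r)) := by
    intro j' r; simp [smul_smul, mul_comm]
  simp only [E, ← A2, Sw_mulR, Sw_smul]
  rw [h.coas i (fun a b r => h.χ r j • (h.χ b j • (h.S (h.e a * h.e j) * h.e b) * h.S (h.e r)))]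
  have := h.dropR_eS i (fun _ r => h.χ r j) (fun _ => h.cL j)
      (fun a => LinearMap.mulLeft k (h.S (h.e a * h.e j)))
  simp only [LinearMap.mulLeft_apply, mul_one] at this
  rw [← this]
  refine h.Sw_congr fun a t => h.Sw_congr fun b c => ?_
  simp only [smul_mul_assoc, smul_smul, mul_assoc]
  congr 1; ring

/-- the right twisting operator -/
noncomputable def T (m : ι) : A →ₗ[k] A := h.dg fun i => h.χ i m
noncomputable def U (m : ι) : A →ₗ[k] A := h.dg fun i => h.χ m i

@[simp] lemma T_e (m i : ι) : h.T m (h.e i) = h.χ i m • h.e i := by simp [T]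
@[simp] lemma U_e (m i : ι) : h.U m (h.e i) = h.χ m i • h.e i := by simp [U]
lemma T_mul (m : ι) (x y : A) : h.T m (x * y) = h.T m x * h.T m y := (h.cL m).dmul x y
lemma U_mul (m : ι) (x y : A) : h.U m (x * y) = h.U m x * h.U m y := (h.cR m).dmul x y
lemma T_S (m : ι) (x : A) : h.T m (h.S x) = h.S (h.T m x) := (h.cL m).anti x
lemma U_S (m : ι) (x : A) : h.U m (h.S x) = h.S (h.U m x) := (h.cR m).anti x
@[simp] lemma T_one (m : ι) : h.T m 1 = 1 := (h.cL m).one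

lemma S_mul' (x : A) (j : ι) : h.S (x * h.e j) = h.S (h.e j) * h.S (h.T j x) := by
  have : h.S ∘ₗ LinearMap.mulRight k (h.e j) =
      LinearMap.mulLeft k (h.S (h.e j)) ∘ₗ h.S ∘ₗ h.T j := by
    apply h.e.ext; intro i
    simp [S_mul]
  simpa using LinearMap.congr_fun this x

lemma S_one : h.S 1 = 1 := by
  have := h.antipode_left 1
  simpa [comul_one, counit_one] using this

lemma S_S (x : A) : h.S (h.S x) = x := by
  suffices h.S ∘ₗ h.S = LinearMap.id from LinearMap.congr_fun this x
  apply h.e.ext; intro i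
  have h1 : ∀ i, (h.Sw i fun a b => h.S (h.e a) * h.S (h.S (h.e b))) = h.ep i • (1 : A) := by
    intro i
    have E : ∀ a b, h.S (h.e a) * h.S (h.S (h.e b)) = h.χ a b • h.S (h.S (h.e b) * h.e a) := by
      intro a b
      rw [S_mul', T_S]; simp [smul_smul, χ_swap]
    simp only [E]
    rw [h.coco i (fun a b => h.S (h.S (h.e a) * h.e b)), ← Sw_map, antL]
    simp [S_one]
  have h2 := h.dropL_eS i (fun _ _ => 1) (fun _ => IsChar.onec h)
    (fun c => LinearMap.mulRight k (h.S (h.S (h.e c))))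
  simp only [LinearMap.comp_apply, LinearMap.id_apply]
  simp at h2
  rw [← h2]
  simp only [mul_assoc]
  rw [h.coas i (fun a b c => h.e a * (h.S (h.e b) * h.S (h.S (h.e c))))]
  simp only [← Sw_mulL, h1]
  simpa using h.couR i (fun a => h.e a)

/-- braided right multiplication -/
noncomputable def bm (x y : A) (p : ι) : A ⊗[k] A →ₗ[k] A ⊗[k] A :=
  TensorProduct.map (LinearMap.mulRight k x) (LinearMap.mulRight k y ∘ₗ h.T p)

lemma Δ_mul_e (z : A) (j : ι) :
    h.Δ (z * h.e j) = h.Sw j fun p q => h.bm (h.e p) (h.e q) p (h.Δ z) := by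
  have : h.Δ ∘ₗ LinearMap.mulRight k (h.e j) =
      (h.Sw j fun p q => h.bm (h.e p) (h.e q) p) ∘ₗ h.Δ := by
    apply h.e.ext; intro i
    simp [Δmul, Sw_apply, Δ_e h i, bm, Sw_map, h.Sw_comm i j]
  simpa [Sw_apply] using LinearMap.congr_fun this z

lemma Δ_S (i : ι) : h.Δ (h.S (h.e i)) = h.Sw i fun a b => h.S (h.e a) ⊗ₜ[k] h.S (h.e b) := by
  -- step 0
  have h0 : ∀ i, (h.Sw i fun a j => h.Sw j fun p q => h.bm (h.e p) (h.e q) p (h.Δ (h.S (h.e a))))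
      = h.ep i • ((1 : A) ⊗ₜ[k] (1 : A)) := by
    intro i
    simp only [← Δ_mul_e]
    rw [← Sw_map, antL, map_smul, comul_one]
  have h1 : ∀ i, (h.Sw i fun a p => h.bm (h.e p) 1 p (h.Δ (h.S (h.e a)))) =
      (1 : A) ⊗ₜ[k] h.S (h.e i) := by
    intro i
    have := h.couL i (fun r => (1 : A) ⊗ₜ[k] h.S (h.e r))
    rw [← this]
    have E : ∀ j r, h.ep j • ((1 : A) ⊗ₜ[k] h.S (h.e r)) =
      (TensorProduct.map LinearMap.id (LinearMap.mulRight k (h.S (h.e r))))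
        (h.ep j • ((1 : A) ⊗ₜ[k] (1 : A))) := by
      intro j r; simp
    simp only [E, ← h0, Sw_map]
    rw [h.coas i (fun a j r => h.Sw j fun p q =>
      (TensorProduct.map LinearMap.id (LinearMap.mulRight k (h.S (h.e r))))
        (h.bm (h.e p) (h.e q) p (h.Δ (h.S (h.e a)))))]
    refine h.Sw_congr fun a j => ?_
    rw [h.coas j (fun p q r =>
      (TensorProduct.map LinearMap.id (LinearMap.mulRight k (h.S (h.e r))))
        (h.bm (h.e p) (h.e q) p (h.Δ (h.S (h.e a)))))]
    generalize h.Δ (h.S (h.e a)) = w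
    induction w using TensorProduct.induction_on with
    | zero => simp [Sw, swOf]
    | add x y hx hy => simp only [map_add, Sw_add, hx, hy]
    | tmul x y =>
      have := h.dropR_eS j (fun _ _ => 1) (fun _ => IsChar.onec h) (fun p =>
        (TensorProduct.mk k A A (x * h.e p)) ∘ₗ (LinearMap.mulLeft k (h.T p y)))
      simpa [bm, mul_assoc] using this.symm
  have h2 : h.Δ (h.S (h.e i)) = h.Sw i fun s r => h.bm (h.S (h.e r)) 1 r
      ((1 : A) ⊗ₜ[k] h.S (h.e s)) := by
    simp only [← h1, Sw_map]
    rw [h.coas i (fun a p r => h.bm (h.S (h.e r)) 1 r (h.bm (h.e p) 1 p (h.Δ (h.S (h.e a)))))]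
    have h3 : ∀ t, (h.Sw t fun p r => h.bm (h.S (h.e r)) 1 r ∘ₗ h.bm (h.e p) 1 p) =
        h.ep t • LinearMap.id := by
      intro t
      apply (h.e.tensorProduct h.e).ext
      rintro ⟨c, d⟩
      have := h.inR_eS t (h.cR d) ((TensorProduct.mk k A A).flip (h.e d) ∘ₗ
        (LinearMap.mulLeft k (h.e c)))
      simpa [bm, mul_assoc, Sw_apply, Module.Basis.tensorProduct_apply', smul_smul] using this
    rw [← h.couR i (fun a => h.Δ (h.S (h.e a)))]
    refine h.Sw_congr fun a t => ?_
    have := LinearMap.congr_fun (h3 t) (h.Δ (h.S (h.e a)))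
    simpa [Sw_apply] using this.symm
  rw [h2, ← h.coco i]
  refine h.Sw_congr fun a b => ?_
  simp [bm, T_S, smul_smul, χ_swap]

lemma I1 (i j : ι) :
    (h.Sw i fun r t => (TensorProduct.map (LinearMap.mulLeft k (h.S (h.e r))) LinearMap.id)
      (h.Δ (h.e t * h.e j))) = h.Sw j fun p q => h.χ i p • (h.e p ⊗ₜ[k] (h.e i * h.e q)) := by
  simp only [Δmul, Sw_map]
  rw [← h.coas i (fun r a b => h.Sw j fun p q => (TensorProduct.map
    (LinearMap.mulLeft k (h.S (h.e r))) LinearMap.id)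
      (h.χ b p • ((h.e a * h.e p) ⊗ₜ[k] (h.e b * h.e q))))]
  simp only [h.Sw_comm _ j]
  refine h.Sw_congr fun p q => ?_
  have := h.dropL_Se i (fun _ _ => 1) (fun _ => IsChar.onec h)
    (fun b => h.χ b p • (TensorProduct.mk k A A).flip (h.e b * h.e q) ∘ₗ
      LinearMap.mulRight k (h.e p))
  simpa [mul_assoc] using this

lemma X3 (i j : ι) :
    (h.Sw i fun s b => h.Sw j fun p q => h.Sw p fun p1 p2 => (h.χ b p * h.χ s p1) •
      (h.e p1 ⊗ₜ[k] ((h.e s * h.e p2) ⊗ₜ[k] (h.e b * h.e q)))) =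
    h.Sw j fun p q => h.Sw i fun a b => h.Sw q fun q1 q2 => (h.χ i p * h.χ b q1) •
      (h.e p ⊗ₜ[k] ((h.e a * h.e q1) ⊗ₜ[k] (h.e b * h.e q2))) := by
  have c1 : ∀ (x : A) (w : A ⊗[k] A), (TensorProduct.map LinearMap.id h.Δ)
      ((TensorProduct.map (LinearMap.mulLeft k x) LinearMap.id) w) =
      (TensorProduct.map (LinearMap.mulLeft k x) LinearMap.id)
        ((TensorProduct.map LinearMap.id h.Δ) w) := by
    intro x w
    induction w using TensorProduct.induction_on with
    | zero => simp
    | add x y hx hy => simp only [map_add, hx, hy]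
    | tmul x y => simp
  have c2 : ∀ (x : A) (w : A ⊗[k] A) (y : A),
      (TensorProduct.map (LinearMap.mulLeft k x) LinearMap.id)
        (TensorProduct.assoc k A A A (w ⊗ₜ[k] y)) =
      TensorProduct.assoc k A A A
        (((TensorProduct.map (LinearMap.mulLeft k x) LinearMap.id) w) ⊗ₜ[k] y) := by
    intro x w y
    induction w using TensorProduct.induction_on with
    | zero => simp
    | add x y hx hy => simp only [map_add, TensorProduct.add_tmul, hx, hy]
    | tmul x y => simp
  have c3 : ∀ t r, (TensorProduct.map LinearMap.id h.Δ)
      ((TensorProduct.map (LinearMap.mulLeft k (h.S (h.e r))) LinearMap.id)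
        (h.Δ (h.e t * h.e j))) = h.Sw t fun a b => h.Sw j fun p q => h.χ b p •
      TensorProduct.assoc k A A A
        (((TensorProduct.map (LinearMap.mulLeft k (h.S (h.e r))) LinearMap.id)
          (h.Δ (h.e a * h.e p))) ⊗ₜ[k] (h.e b * h.e q)) := by
    intro t r
    rw [c1]
    have := LinearMap.congr_fun h.coassoc (h.e t * h.e j)
    simp only [LinearMap.comp_apply] at this
    rw [← this, Δmul]
    simp only [Sw_map, LinearEquiv.coe_coe, Sw_mapE, map_smul, TensorProduct.map_tmul,
      LinearMap.id_apply, c2]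
  have H := congrArg (TensorProduct.map LinearMap.id h.Δ) (h.I1 i j)
  rw [Sw_map, h.Sw_congr (fun r t => c3 t r)] at H
  conv_rhs at H =>
    simp only [Sw_map, map_smul, TensorProduct.map_tmul, LinearMap.id_apply, Δmul, Sw_tmulL,
      Sw_smul, TensorProduct.tmul_smul, smul_smul]
  rw [← H]
  rw [← h.coas i (fun r a b => h.Sw j fun p q => h.χ b p •
      TensorProduct.assoc k A A A
        (((TensorProduct.map (LinearMap.mulLeft k (h.S (h.e r))) LinearMap.id)
          (h.Δ (h.e a * h.e p))) ⊗ₜ[k] (h.e b * h.e q)))]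
  refine h.Sw_congr fun s b => ?_
  rw [h.Sw_comm s j]
  refine h.Sw_congr fun p q => ?_
  rw [← Sw_smul, ← Sw_mapE, ← Sw_tmulR, I1]
  simp only [Sw_mapE, Sw_tmulR, Sw_smul, TensorProduct.smul_tmul', map_smul,
    TensorProduct.assoc_tmul, smul_smul]

lemma R0 (i j : ι) :
    (h.Sw i fun a b => h.Sw j fun p q => (h.χ b j * h.χ a p) •
      (h.e p ⊗ₜ[k] ((h.e a * h.e q) ⊗ₜ[k] h.e b))) =
    h.Sw i fun a b => h.Sw j fun p q => (h.χ i p * h.χ b q) •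
      (h.e p ⊗ₜ[k] ((h.e a * h.e q) ⊗ₜ[k] h.e b)) := by
  let P : A → (A ⊗[k] (A ⊗[k] A) →ₗ[k] A ⊗[k] (A ⊗[k] A)) := fun x =>
    TensorProduct.map LinearMap.id (TensorProduct.map LinearMap.id (LinearMap.mulRight k x))
  have H : (h.Sw j fun j' r => P (h.S (h.e r)) (h.Sw i fun s b => h.Sw j' fun p q =>
      h.Sw p fun p1 p2 => (h.χ b p * h.χ s p1) •
      (h.e p1 ⊗ₜ[k] ((h.e s * h.e p2) ⊗ₜ[k] (h.e b * h.e q))))) =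
    h.Sw j fun j' r => P (h.S (h.e r)) (h.Sw j' fun p q => h.Sw i fun a b =>
      h.Sw q fun q1 q2 => (h.χ i p * h.χ b q1) •
      (h.e p ⊗ₜ[k] ((h.e a * h.e q1) ⊗ₜ[k] (h.e b * h.e q2)))) :=
    h.Sw_congr fun j' r => by rw [X3]
  simp only [Sw_map, map_smul, P, TensorProduct.map_tmul, LinearMap.id_apply,
    LinearMap.mulRight_apply] at H
  have L : ∀ s b, (h.Sw j fun j' r => h.Sw j' fun p q => h.Sw p fun p1 p2 =>
      (h.χ b p * h.χ s p1) • (h.e p1 ⊗ₜ[k] ((h.e s * h.e p2) ⊗ₜ[k]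
        (h.e b * h.e q * h.S (h.e r))))) = h.Sw j fun p q => (h.χ b j * h.χ s p) •
      (h.e p ⊗ₜ[k] ((h.e s * h.e q) ⊗ₜ[k] h.e b)) := by
    intro s b
    rw [h.coas j (fun p q r => h.Sw p fun p1 p2 =>
      (h.χ b p * h.χ s p1) • (h.e p1 ⊗ₜ[k] ((h.e s * h.e p2) ⊗ₜ[k]
        (h.e b * h.e q * h.S (h.e r)))))]
    have := h.dropR_eS j (fun _ _ => 1) (fun _ => IsChar.onec h)
      (fun p => h.Sw p fun p1 p2 => (h.χ b p * h.χ s p1) • (TensorProduct.mk k A (A ⊗[k] A) (h.e p1))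
        ∘ₗ (TensorProduct.mk k A A (h.e s * h.e p2)) ∘ₗ LinearMap.mulLeft k (h.e b))
    simpa [Sw_apply, mul_assoc] using this
  have Rr : ∀ a b, (h.Sw j fun j' r => h.Sw j' fun p q =>
      h.Sw q fun q1 q2 => (h.χ i p * h.χ b q1) •
      (h.e p ⊗ₜ[k] ((h.e a * h.e q1) ⊗ₜ[k] (h.e b * h.e q2 * h.S (h.e r))))) =
      h.Sw j fun p q => (h.χ i p * h.χ b q) •
      (h.e p ⊗ₜ[k] ((h.e a * h.e q) ⊗ₜ[k] h.e b)) := by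
    intro a b
    rw [h.coas j (fun p q r => h.Sw q fun q1 q2 => (h.χ i p * h.χ b q1) •
      (h.e p ⊗ₜ[k] ((h.e a * h.e q1) ⊗ₜ[k] (h.e b * h.e q2 * h.S (h.e r)))))]
    refine h.Sw_congr fun p t => ?_
    rw [h.coas t (fun q1 q2 r => (h.χ i p * h.χ b q1) •
      (h.e p ⊗ₜ[k] ((h.e a * h.e q1) ⊗ₜ[k] (h.e b * h.e q2 * h.S (h.e r)))))]
    have := h.dropR_eS t (fun _ _ => 1) (fun _ => IsChar.onec h)
      (fun q => (h.χ i p * h.χ b q) • (TensorProduct.mk k A (A ⊗[k] A) (h.e p))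
        ∘ₗ (TensorProduct.mk k A A (h.e a * h.e q)) ∘ₗ LinearMap.mulLeft k (h.e b))
    simpa [mul_assoc] using this
  have HL := h.Sw_congr (i := i) L
  rw [← HL, ← h.Sw_congr (i := i) Rr]
  rw [h.Sw_comm i j, H, h.Sw_comm i j]
  refine h.Sw_congr fun j' r => ?_
  exact (h.Sw_comm i j' _).symm

lemma R (i j : ι) (F : ι → ι → A →ₗ[k] M) :
    (h.Sw i fun a b => h.Sw j fun p q => (h.χ b j * h.χ a p) • F p b (h.e a * h.e q)) =
    h.Sw i fun a b => h.Sw j fun p q => (h.χ i p * h.χ b q) • F p b (h.e a * h.e q) := by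
  let L : A ⊗[k] (A ⊗[k] A) →ₗ[k] M := TensorProduct.lift
    (h.e.constr k fun p => TensorProduct.lift (h.e.constr k fun b => F p b).flip)
  have H := congrArg L (h.R0 i j)
  simpa [Sw_map, L] using H

lemma K1 (i j : ι) (G : ι → A →ₗ[k] M) :
    (h.Sw i fun a b => h.Sw j fun p q => (h.χ i p * (h.χ a q * h.χ b q)) •
      G b (h.e p * h.S (h.e q) * h.S (h.e a))) =
    h.ep j • h.Sw i fun a b => G b (h.S (h.e a)) := by
  have H := h.R i j (fun p b => G b ∘ₗ LinearMap.mulLeft k (h.e p) ∘ₗ h.S)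
  simp only [LinearMap.comp_apply, S_mul, LinearMap.mulLeft_apply, mul_smul_comm, map_smul,
    smul_smul] at H
  refine Eq.trans (h.Sw_congr fun a b => h.Sw_congr fun p q => ?_) (H.symm.trans ?_)
  · rw [mul_assoc (h.e p)]; congr 1; ring
  rw [Sw_smul]
  refine h.Sw_congr fun a b => ?_
  have := h.inR_eS j (h.cR a) (h.χ b j • G b ∘ₗ LinearMap.mulRight k (h.S (h.e a)))
  simp only [LinearMap.smul_apply, smul_smul, ep_χ', LinearMap.comp_apply,
    LinearMap.mulRight_apply, one_mul] at this
  rw [← this]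
  refine h.Sw_congr fun p q => ?_
  rw [mul_assoc (h.e p)]; congr 1; ring

lemma K2 (i j : ι) (G : ι → A →ₗ[k] M) :
    (h.Sw i fun a b => (h.χ a j * h.χ b j) • G b (h.S (h.e j) * h.S (h.e a))) =
    h.Sw i fun a b => h.χ i j • G b (h.S (h.e j) * h.S (h.e a)) := by
  rw [← h.couR j (fun r => h.Sw i fun a b => h.χ i r • G b (h.S (h.e r) * h.S (h.e a)))]
  have E : ∀ r j', (h.ep j' • h.Sw i fun a b => h.χ i r • G b (h.S (h.e r) * h.S (h.e a))) =
      h.Sw i fun a b => h.Sw j' fun p q => (h.χ i r * (h.χ i p * (h.χ a q * h.χ b q))) •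
      G b (h.S (h.e r) * h.e p * h.S (h.e q) * h.S (h.e a)) := by
    intro r j'
    have := h.K1 i j' (fun b => h.χ i r • G b ∘ₗ LinearMap.mulLeft k (h.S (h.e r)))
    simp only [LinearMap.smul_apply, LinearMap.comp_apply, LinearMap.mulLeft_apply] at this
    rw [← this]
    refine h.Sw_congr fun a b => h.Sw_congr fun p q => ?_
    rw [smul_smul]; simp only [mul_assoc]; congr 1; ring
  rw [h.Sw_congr E, h.Sw_comm j i]
  refine h.Sw_congr fun a b => ?_
  rw [← h.coas j (fun r p q => (h.χ i r * (h.χ i p * (h.χ a q * h.χ b q))) •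
      G b (h.S (h.e r) * h.e p * h.S (h.e q) * h.S (h.e a)))]
  have := h.dropL_Se j (fun _ p => h.χ i p) (fun _ => h.cR i)
    (fun q => (h.χ a q * h.χ b q) • G b ∘ₗ LinearMap.mulRight k (h.S (h.e q) * h.S (h.e a)))
  simp only [LinearMap.smul_apply, LinearMap.comp_apply, LinearMap.mulRight_apply, one_mul] at this
  rw [← this]
  refine h.Sw_congr fun t q => h.Sw_congr fun r p => ?_
  rw [smul_smul, mul_assoc (h.S (h.e r) * h.e p)]; congr 1; ring

lemma K3 (i : ι) (z : A) (G : ι → A →ₗ[k] M) :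
    (h.Sw i fun a b => G b (h.U a (h.U b z) * h.S (h.e a))) =
    h.Sw i fun a b => G b (h.U i z * h.S (h.e a)) := by
  have : (h.Sw i fun a b => G b ∘ₗ LinearMap.mulRight k (h.S (h.e a)) ∘ₗ h.S ∘ₗ h.U a ∘ₗ h.U b) =
    h.Sw i fun a b => G b ∘ₗ LinearMap.mulRight k (h.S (h.e a)) ∘ₗ h.S ∘ₗ h.U i := by
    apply h.e.ext; intro j
    have := h.K2 i j G
    simpa [Sw_apply, smul_smul, mul_comm] using this
  have := LinearMap.congr_fun this (h.S z)
  simpa [Sw_apply, U_S, S_S] using this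

/-- Constant multiples of characters. -/
def QC (τ : ι → k) : Prop := ∃ c σ, h.IsChar σ ∧ ∀ i, τ i = c * σ i

variable {h} in
lemma QC.mulc {τ σ : ι → k} (ht : h.QC τ) (hs : h.QC σ) : h.QC (fun i => τ i * σ i) := by
  obtain ⟨c, t, h1, h2⟩ := ht
  obtain ⟨d, s, h3, h4⟩ := hs
  exact ⟨c * d, fun i => t i * s i, h1.mulc h3, fun i => by simp only [h2, h4]; ring⟩

lemma QC.const (c : k) : h.QC (fun _ => c) := ⟨c, fun _ => 1, IsChar.onec h, fun _ => by simp⟩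

variable {h} in
lemma IsChar.qc {τ : ι → k} (ht : h.IsChar τ) : h.QC τ := ⟨1, τ, ht, fun _ => by simp⟩

lemma qL (m : ι) : h.QC (fun i => h.χ i m) := (h.cL m).qc
lemma qR (m : ι) : h.QC (fun i => h.χ m i) := (h.cR m).qc

lemma F1e (i m n : ι) (B : ι → A →ₗ[k] M) :
    (h.Sw i fun a b => (h.χ a m * h.χ b m) • B b (h.e m * h.e n * h.S (h.e a))) =
    h.Sw i fun a b => h.χ i m • B b (h.e m * h.e n * h.S (h.e a)) := by
  have k1 := h.K3 i (h.e m * h.e n) B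
  have k2 := h.K3 i (h.e n) (fun b => (h.χ b m * h.χ m n) • B b ∘ₗ LinearMap.mulLeft k (h.e m) ∘ₗ
    h.T m)
  have : h.χ i n • (h.Sw i fun a b => (h.χ a m * h.χ b m) •
      B b (h.e m * h.e n * h.S (h.e a))) =
    h.χ i n • h.Sw i fun a b => h.χ i m • B b (h.e m * h.e n * h.S (h.e a)) := by
    simp only [U_mul, U_e, map_smul, smul_mul_assoc, mul_smul_comm, smul_smul,
      LinearMap.smul_apply, LinearMap.comp_apply, T_mul, T_S, T_e, LinearMap.mulLeft_apply] at k1 k2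
    rw [Sw_smul, Sw_smul]
    have e1 : ∀ a b : ι, h.χ i n • (h.χ a m * h.χ b m) • B b (h.e m * h.e n * h.S (h.e a)) =
        (h.χ i n * (h.χ b m * h.χ m n) * h.χ a m * h.χ n m) •
          B b (h.e m * (h.e n * h.S (h.e a))) := by
      intro a b
      rw [smul_smul, mul_assoc (h.e m)]; congr 1
      linear_combination (-h.χ i n * h.χ b m * h.χ a m) * h.χ_swap m n
    rw [h.Sw_congr e1]
    refine Eq.trans (h.Sw_congr fun a b => ?_)
      (k2.symm.trans (Eq.trans (h.Sw_congr fun a b => ?_) (k1.trans (h.Sw_congr fun a b => ?_))))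
    · congr 1; try ring
    · rw [mul_assoc (h.e m)]; congr 1
      linear_combination (h.χ a n * h.χ b n * h.χ b m * h.χ a m) * h.χ_swap m n
    · rw [smul_smul]
  exact smul_right_injective M (h.χne i n) this

lemma F1 (i m : ι) (u : A) (τ : ι → ι → k) (hτ : ∀ b, h.QC (τ b)) (B : ι → A →ₗ[k] M) :
    (h.Sw i fun a b => (h.χ a m * h.χ b m * τ b a) • B b (h.e m * u * h.S (h.e a))) =
    h.Sw i fun a b => (h.χ i m * τ b a) • B b (h.e m * u * h.S (h.e a)) := by
  choose c σ hσ hc using hτ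
  have : (h.Sw i fun a b => (h.χ a m * h.χ b m * τ b a) •
        B b ∘ₗ LinearMap.mulRight k (h.S (h.e a)) ∘ₗ LinearMap.mulLeft k (h.e m)) =
      h.Sw i fun a b => (h.χ i m * τ b a) • B b ∘ₗ LinearMap.mulRight k (h.S (h.e a)) ∘ₗ
        LinearMap.mulLeft k (h.e m) := by
    apply h.e.ext; intro n
    have := h.F1e i m n (fun b => (c b * (σ b m * σ b n)⁻¹) • B b ∘ₗ h.dg (σ b))
    simp only [LinearMap.smul_apply, LinearMap.comp_apply, (hσ _).dmul, (hσ _).antS, dg_e,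
      smul_mul_assoc, mul_smul_comm, map_smul, smul_smul] at this
    simp only [Sw_apply, LinearMap.smul_apply, LinearMap.comp_apply, LinearMap.mulLeft_apply,
      LinearMap.mulRight_apply, hc]
    refine Eq.trans (h.Sw_congr fun a b => ?_) (this.trans (h.Sw_congr fun a b => ?_))
    · congr 1
      have := (hσ b).ne m; have := (hσ b).ne n
      field_simp
    · congr 1
      have := (hσ b).ne m; have := (hσ b).ne n
      field_simp
  have := LinearMap.congr_fun this u
  simpa [Sw_apply] using this

lemma F1ii (i m : ι) (u : A) (τ : ι → ι → k) (hτ : ∀ a, h.QC (τ a)) (B : ι → A →ₗ[k] M) :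
    (h.Sw i fun a b => (h.χ a m * h.χ b m * τ a b) • B a (h.e m * u * h.S (h.e b))) =
    h.Sw i fun a b => (h.χ i m * τ a b) • B a (h.e m * u * h.S (h.e b)) := by
  have := h.F1 i m u (fun b a => h.χ a b * τ b a) (fun b => (h.qL b).mulc (hτ b)) B
  rw [← h.coco i, ← h.coco i (fun a b => (h.χ i m * τ a b) • B a (h.e m * u * h.S (h.e b)))]
  simp only [smul_smul]
  refine Eq.trans (h.Sw_congr fun a b => ?_) (this.trans (h.Sw_congr fun a b => ?_))
  · congr 1; ring
  · congr 1; ring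

lemma F1N (i m : ι) (τ : ι → ι → ι → ι → k) (hτ : ∀ s a d, h.QC (τ s a d))
    (B : ι → ι → ι → A →ₗ[k] M) :
    (h.Sw i fun s c => h.Sw s fun a d => (h.χ s m * h.χ c m * τ s a d c) •
      B s a d (h.e m * h.S (h.e c))) =
    h.Sw i fun s c => h.Sw s fun a d => (h.χ i m * τ s a d c) •
      B s a d (h.e m * h.S (h.e c)) := by
  choose κ σ hσ hc using hτ
  have := h.F1ii i m 1 (fun _ _ => 1) (fun _ => QC.const h 1) (fun s => h.Sw s fun a d =>
    (κ s a d * (σ s a d m)⁻¹) • B s a d ∘ₗ h.dg (σ s a d))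
  simp only [Sw_apply, LinearMap.smul_apply, LinearMap.comp_apply, (hσ _ _ _).dmul,
    (hσ _ _ _).antS, dg_e, mul_one, Sw_smul,
      smul_mul_assoc, mul_smul_comm, map_smul, smul_smul] at this
  simp only [hc]
  refine Eq.trans (h.Sw_congr fun a b => h.Sw_congr fun x y => ?_)
    (this.trans (h.Sw_congr fun a b => h.Sw_congr fun x y => ?_))
  · congr 1
    have := (hσ a x y).ne m
    field_simp
  · congr 1
    have := (hσ a x y).ne m
    field_simp

lemma F2star (i j : ι) (v : ι → A) (τ : ι → ι → k) (hτ : ∀ p, h.IsChar (τ p))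
    (G : ι → ι → A →ₗ[k] M) :
    (h.Sw i fun a b => h.Sw j fun p q =>
      (h.χ b j * (h.χ a p * h.χ a q * τ p a * τ p q)) •
        G p b (h.e p * v p * h.S (h.e q) * h.S (h.e a))) =
    h.Sw i fun a b => h.Sw j fun p q =>
      (h.χ b p * h.χ b q * (h.χ a p * h.χ a q * τ p a * τ p q)) •
        G p b (h.e p * v p * h.S (h.e q) * h.S (h.e a)) := by
  have H := h.R i j (fun p b => G p b ∘ₗ LinearMap.mulLeft k (h.e p * v p) ∘ₗ h.S ∘ₗ h.dg (τ p))
  simp only [LinearMap.comp_apply, (hτ _).dmul, dg_e, smul_mul_assoc, mul_smul_comm, map_smul,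
    smul_smul, S_mul, LinearMap.mulLeft_apply] at H
  refine Eq.trans (h.Sw_congr fun a b => h.Sw_congr fun p q => ?_) (H.trans ?_)
  · rw [mul_assoc (h.e p * v p)]; congr 1; ring
  rw [h.Sw_comm i j, h.Sw_comm i j]
  refine h.Sw_congr fun p q => ?_
  have := h.F1 i p (v p * h.S (h.e q)) (fun b a => h.χ b q * τ p q * (h.χ a q * τ p a))
    (fun b => (QC.const h _).mulc ((h.qL q).mulc (hτ p).qc)) (fun b => G p b)
  refine Eq.trans (h.Sw_congr fun a b => ?_) (this.symm.trans (h.Sw_congr fun a b => ?_))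
  · simp only [mul_assoc]; congr 1; ring
  · simp only [mul_assoc]; congr 1; ring

lemma F2c (m j : ι) (v : ι → A) (τ : ι → ι → k) (hτ : ∀ p, h.IsChar (τ p))
    (G : ι → A →ₗ[k] M) :
    (h.Sw j fun p q => (h.χ m j * τ p q) • G p (h.e p * v p * h.S (h.e q))) =
    h.Sw j fun p q => (h.χ m p * h.χ m q * τ p q) • G p (h.e p * v p * h.S (h.e q)) := by
  -- cancellation
  have key : ∀ (w : ι → ι → ι → k),
      (h.Sw m fun r i' => h.Sw i' fun a b => h.Sw j fun p q =>
      (w b p q * (h.χ a p * h.χ a q * (h.χ r a * τ p a) * (h.χ r q * τ p q)) *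
        (h.χ r p * τ p r)) •
        G p (h.e p * v p * h.S (h.e q) * h.S (h.e a) * h.e r)) =
      h.Sw j fun p q => (w m p q * τ p q) • G p (h.e p * v p * h.S (h.e q)) := by
    intro w
    rw [← h.coas m (fun r a b => h.Sw j fun p q =>
      (w b p q * (h.χ a p * h.χ a q * (h.χ r a * τ p a) * (h.χ r q * τ p q)) *
        (h.χ r p * τ p r)) •
        G p (h.e p * v p * h.S (h.e q) * h.S (h.e a) * h.e r))]
    simp only [h.Sw_comm _ j]
    refine h.Sw_congr fun p q => ?_
    have E := h.dropL_Se m (fun _ a => h.χ a p * h.χ a q * τ p a)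
      (fun _ => ((h.cL p).mulc (h.cL q)).mulc (hτ p))
      (fun b => (w b p q * τ p q) • G p ∘ₗ LinearMap.mulLeft k (h.e p * v p * h.S (h.e q)))
    simp only [LinearMap.smul_apply, LinearMap.comp_apply, LinearMap.mulLeft_apply, mul_one] at E
    rw [← E]
    refine h.Sw_congr fun t b => ?_
    rw [← h.coco t]
    refine h.Sw_congr fun r a => ?_
    rw [smul_smul, smul_smul, mul_assoc _ (h.S (h.e r))]
    congr 1
    linear_combination (w b p q * (h.χ r p * h.χ r q * τ p r) * (h.χ a q * τ p q) *
      (h.χ a p * τ p a)) * h.χ_swap r a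
  have H : ∀ r i', _ := fun r i' => h.F2star i' j v (fun p a => h.χ r a * τ p a)
    (fun p => (h.cR r).mulc (hτ p))
    (fun p b => (h.χ r p * τ p r) • G p ∘ₗ LinearMap.mulRight k (h.e r))
  have H' := h.Sw_congr (i := m) H
  simp only [LinearMap.smul_apply, LinearMap.comp_apply, LinearMap.mulRight_apply, smul_smul] at H'
  have k1 := key (fun b p q => h.χ b j)
  have k2 := key (fun b p q => h.χ b p * h.χ b q)
  exact k1.symm.trans (H'.trans k2)

lemma F2 (m j : ι) (v : ι → A) (τ : ι → ι → k) (hτ : ∀ p, h.QC (τ p))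
    (G : ι → A →ₗ[k] M) :
    (h.Sw j fun p q => (h.χ m j * τ p q) • G p (h.e p * v p * h.S (h.e q))) =
    h.Sw j fun p q => (h.χ m p * h.χ m q * τ p q) • G p (h.e p * v p * h.S (h.e q)) := by
  choose c σ hσ hc using hτ
  have := h.F2c m j v σ hσ (fun p => c p • G p)
  simp only [LinearMap.smul_apply, smul_smul] at this
  simp only [hc]
  refine Eq.trans (h.Sw_congr fun a b => ?_) (this.trans (h.Sw_congr fun a b => ?_))
  · congr 1; ring
  · congr 1; ring

lemma F2' (m j : ι) (v : ι → A) (τ : ι → ι → k) (hτ : ∀ p, h.QC (τ p))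
    (G : ι → A →ₗ[k] M) :
    (h.Sw j fun p q => (h.χ j m * τ p q) • G p (h.e p * v p * h.S (h.e q))) =
    h.Sw j fun p q => (h.χ p m * h.χ q m * τ p q) • G p (h.e p * v p * h.S (h.e q)) := by
  have := congrArg (fun x => h.χ j m • x) (h.F2 m j v (fun p q => h.χ p m * (τ p q * h.χ q m))
    (fun p => (QC.const h _).mulc ((hτ p).mulc (h.qL m))) G)
  simp only [Sw_smul, smul_smul] at this
  refine Eq.trans (h.Sw_congr fun a b => ?_) (this.symm.trans (h.Sw_congr fun a b => ?_))
  · congr 1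
    linear_combination (-h.χ j m * τ a b) * h.χ_swap m a
      + (-h.χ j m * τ a b * h.χ m a * h.χ a m) * h.χ_swap m b
  · congr 1
    linear_combination (h.χ a m * τ a b * h.χ b m) * h.χ_swap j m

lemma regroup (i : ι) (f : ι → ι → ι → M) :
    (h.Sw i fun a b => h.Sw b fun c d => f a c d) =
      h.Sw i fun s c => h.Sw s fun a d => h.χ d c • f a c d := by
  rw [h.coas i (fun a d c => h.χ d c • f a c d)]
  refine h.Sw_congr fun a b => ?_
  exact (h.coco b (fun c d => f a c d)).symm

lemma DE (i j : ι) (s : ι → ι → ι → k) (t : ι → ι → ι → ι → k)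
    (ht : ∀ p c d, h.IsChar (t p c d))
    (htc : ∀ p d q, h.QC (fun c => t p c d q)) (htd : ∀ p c q, h.QC (fun d => t p c d q))
    (hsc : ∀ p d, h.QC (fun c => s p c d)) (hsd : ∀ p c, h.QC (fun d => s p c d))
    (B : A →ₗ[k] A →ₗ[k] M) :
    (h.Sw i fun a b => h.Sw j fun p q => h.Sw b fun c d =>
      (h.χ b j * (h.χ a p * (s p c d * t p c d a * t p c d q))) •
        B (h.e p * h.S (h.e c)) (h.e a * h.e q * h.S (h.e d))) =
    h.Sw i fun a b => h.Sw j fun p q => h.Sw b fun c d =>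
      (h.χ c p * h.χ d p * h.χ c q * h.χ d q *
        (h.χ a p * (s p c d * t p c d a * t p c d q))) •
        B (h.e p * h.S (h.e c)) (h.e a * h.e q * h.S (h.e d)) := by
  have H := h.R i j (fun p b => h.Sw b fun c d => s p c d •
    B (h.e p * h.S (h.e c)) ∘ₗ LinearMap.mulRight k (h.S (h.e d)) ∘ₗ h.dg (t p c d))
  simp only [Sw_apply, LinearMap.smul_apply, LinearMap.comp_apply, (ht _ _ _).dmul, dg_e,
    LinearMap.mulRight_apply, smul_mul_assoc, mul_smul_comm, map_smul, Sw_smul, smul_smul] at H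
  refine Eq.trans (h.Sw_congr fun a b => h.Sw_congr fun p q => h.Sw_congr fun c d => ?_)
    (H.trans ?_)
  · congr 1; ring
  rw [h.Sw_comm i j, h.Sw_comm i j]
  refine h.Sw_congr fun p q => ?_
  have s1 : ∀ a b, (h.Sw b fun c d => (h.χ i p * h.χ b q * (s p c d * (t p c d q * t p c d a))) •
        B (h.e p * h.S (h.e c)) (h.e a * h.e q * h.S (h.e d))) =
      h.Sw b fun c d => (h.χ i p * (h.χ c q * h.χ d q * (s p c d * t p c d a * t p c d q))) •
        B (h.e p * h.S (h.e c)) (h.e a * h.e q * h.S (h.e d)) := by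
    intro a b
    have := h.F1ii b q 1 (fun c d => h.χ i p * (s p c d * t p c d a * t p c d q))
      (fun c => (QC.const h _).mulc (((hsd p c).mulc (htd p c a)).mulc (htd p c q)))
      (fun c => B (h.e p * h.S (h.e c)) ∘ₗ LinearMap.mulLeft k (h.e a))
    simp only [LinearMap.comp_apply, LinearMap.mulLeft_apply, mul_one] at this
    refine Eq.trans (h.Sw_congr fun c d => ?_) (this.symm.trans (h.Sw_congr fun c d => ?_))
    · rw [mul_assoc (h.e a)]; congr 1; ring
    · rw [mul_assoc (h.e a)]; congr 1; ring
  have s1' := h.Sw_congr (i := i) s1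
  refine Eq.trans (h.Sw_congr fun a b => h.Sw_congr fun c d => ?_) (s1'.trans ?_)
  · congr 1
  rw [h.regroup i (fun a c d => (h.χ i p * (h.χ c q * h.χ d q *
      (s p c d * t p c d a * t p c d q))) •
        B (h.e p * h.S (h.e c)) (h.e a * h.e q * h.S (h.e d))),
    h.regroup i (fun a c d => (h.χ c p * h.χ d p * h.χ c q * h.χ d q *
        (h.χ a p * (s p c d * t p c d a * t p c d q))) •
        B (h.e p * h.S (h.e c)) (h.e a * h.e q * h.S (h.e d)))]
  have s2 := h.F1N i p (fun _ a d c => h.χ d c * (h.χ c q * h.χ d q *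
      (s p c d * t p c d a * t p c d q)))
    (fun _ a d => (h.qR d).mulc (((h.qL q).mulc (QC.const h _)).mulc
      (((hsc p d).mulc (htc p d a)).mulc (htc p d q))))
    (fun _ a d => B.flip (h.e a * h.e q * h.S (h.e d)))
  simp only [LinearMap.flip_apply] at s2
  have s3 : ∀ s' c, (h.Sw s' fun a d => (h.χ s' p * (h.χ c p * (h.χ d c * (h.χ c q * h.χ d q *
      (s p c d * t p c d a * t p c d q))))) •
        B (h.e p * h.S (h.e c)) (h.e a * h.e q * h.S (h.e d))) = _ := fun s' c =>
    h.F2' p s' (fun _ => h.e q) (fun a d => (h.χ c p * (h.χ d c * (h.χ c q * h.χ d q *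
      (s p c d * t p c d a * t p c d q)))))
      (fun a => (QC.const h _).mulc ((h.qL c).mulc (((QC.const h _).mulc (h.qL q)).mulc
        (((hsd p c).mulc (htd p c a)).mulc (htd p c q)))))
      (fun a => B (h.e p * h.S (h.e c)))
  refine Eq.trans (h.Sw_congr fun a b => h.Sw_congr fun c d => ?_)
    (s2.symm.trans (Eq.trans (h.Sw_congr fun a b => h.Sw_congr fun c d => ?_)
      ((h.Sw_congr s3).trans (h.Sw_congr fun a b => h.Sw_congr fun c d => ?_))))
  · rw [smul_smul]; congr 1; ring
  · congr 1; ring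
  · rw [smul_smul]; congr 1; ring

lemma DS (i j : ι) (s : ι → ι → ι → k) (t : ι → ι → ι → ι → k)
    (ht : ∀ p c d, h.IsChar (t p c d))
    (htc : ∀ p d q, h.QC (fun c => t p c d q)) (htd : ∀ p c q, h.QC (fun d => t p c d q))
    (hsc : ∀ p d, h.QC (fun c => s p c d)) (hsd : ∀ p c, h.QC (fun d => s p c d))
    (B : A →ₗ[k] A →ₗ[k] M) :
    (h.Sw i fun c d => h.Sw j fun p q => (h.χ i j * (s p c d * t p c d q)) •
        B (h.e p * h.S (h.e c)) (h.e q * h.S (h.e d))) =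
    h.Sw i fun c d => h.Sw j fun p q => (h.χ c p * h.χ d p * h.χ c q * h.χ d q *
        (s p c d * t p c d q)) •
        B (h.e p * h.S (h.e c)) (h.e q * h.S (h.e d)) := by
  have key : ∀ (w : ι → ι → ι → ι → ι → k),
      (h.Sw i fun r i' => h.Sw i' fun a b => h.Sw j fun p q => h.Sw b fun c d =>
        (w b p q c d * (h.χ a p * (h.χ r p * (s p c d * t p c d r) * t p c d a * t p c d q))) •
          B (h.e p * h.S (h.e c)) (h.S (h.e r) * (h.e a * h.e q * h.S (h.e d)))) =
      h.Sw i fun c d => h.Sw j fun p q => (w i p q c d * (s p c d * t p c d q)) •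
        B (h.e p * h.S (h.e c)) (h.e q * h.S (h.e d)) := by
    intro w
    rw [← h.coas i (fun r a b => h.Sw j fun p q => h.Sw b fun c d =>
        (w b p q c d * (h.χ a p * (h.χ r p * (s p c d * t p c d r) * t p c d a * t p c d q))) •
          B (h.e p * h.S (h.e c)) (h.S (h.e r) * (h.e a * h.e q * h.S (h.e d))))]
    rw [h.Sw_comm i j]
    simp only [h.Sw_comm _ j]
    refine h.Sw_congr fun p q => ?_
    rw [← h.couL i (fun b => h.Sw b fun c d => (w b p q c d * (s p c d * t p c d q)) •
        B (h.e p * h.S (h.e c)) (h.e q * h.S (h.e d)))]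
    refine h.Sw_congr fun u b => ?_
    rw [h.Sw_comm u b, Sw_smul]
    refine h.Sw_congr fun c d => ?_
    have := h.inL_Se u ((h.cL p).mulc (ht p c d))
      ((w b p q c d * (s p c d * t p c d q)) • B (h.e p * h.S (h.e c)) ∘ₗ
        LinearMap.mulRight k (h.e q * h.S (h.e d)))
    simp only [LinearMap.smul_apply, LinearMap.comp_apply, LinearMap.mulRight_apply,
      one_mul] at this
    rw [← this]
    refine h.Sw_congr fun r a => ?_
    rw [smul_smul, mul_assoc (h.S (h.e r)), mul_assoc (h.e a)]
    congr 1; ring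
  have H : ∀ r i', _ := fun r i' => h.DE i' j
    (fun p c d => h.χ r p * (s p c d * t p c d r)) t ht htc htd
    (fun p d => (QC.const h _).mulc ((hsc p d).mulc (htc p d r)))
    (fun p c => (QC.const h _).mulc ((hsd p c).mulc (htd p c r)))
    ((LinearMap.mulLeft k (h.S (h.e r))).lcomp k M ∘ₗ B)
  have H' := h.Sw_congr (i := i) H
  simp only [LinearMap.comp_apply, LinearMap.lcomp_apply, LinearMap.mulLeft_apply] at H'
  exact (key (fun b p q c d => h.χ b j)).symm.trans (H'.trans
    (key (fun b p q c d => h.χ c p * h.χ d p * h.χ c q * h.χ d q)))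

lemma Δ_e_mul (i : ι) (y : A) :
    h.Δ (h.e i * y) = h.Sw i fun c d =>
      (TensorProduct.map (LinearMap.mulLeft k (h.e c) ∘ₗ h.U d) (LinearMap.mulLeft k (h.e d)))
        (h.Δ y) := by
  have : h.Δ ∘ₗ LinearMap.mulLeft k (h.e i) = (h.Sw i fun c d =>
      (TensorProduct.map (LinearMap.mulLeft k (h.e c) ∘ₗ h.U d) (LinearMap.mulLeft k (h.e d))))
        ∘ₗ h.Δ := by
    apply h.e.ext; intro j
    simp [Δmul, Sw_apply, Δ_e h j, Sw_map]
    rw [h.Sw_comm i j]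
    simp only [TensorProduct.smul_tmul']
  simpa [Sw_apply] using LinearMap.congr_fun this y

lemma Δ_mul_S (z : A) (j : ι) :
    h.Δ (z * h.S (h.e j)) = h.Sw j fun p q => h.bm (h.S (h.e p)) (h.S (h.e q)) p (h.Δ z) := by
  have : h.Δ ∘ₗ LinearMap.mulRight k (h.S (h.e j)) =
      (h.Sw j fun p q => h.bm (h.S (h.e p)) (h.S (h.e q)) p) ∘ₗ h.Δ := by
    apply h.e.ext; intro i
    simp [Δ_e_mul, Sw_apply, Δ_e h i, bm, Sw_map, h.Sw_comm i j, Δ_S, U_S]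
    simp only [TensorProduct.smul_tmul']
  simpa [Sw_apply] using LinearMap.congr_fun this z

/-- a fourfold product -/
noncomputable def q4 (a p b q : ι) : A := h.e a * h.e p * h.S (h.e b) * h.S (h.e q)

/-- the commutator of basis elements -/
noncomputable def cm (i j : ι) : A :=
  h.Sw i fun a b => h.Sw j fun p q => h.χ b p • h.q4 a p b q

lemma Δ_q4 (a p b q : ι) : h.Δ (h.q4 a p b q) =
    h.Sw q fun q1 q2 => h.Sw b fun b1 b2 => h.Sw p fun p1 p2 => h.Sw a fun a1 a2 =>
      (h.χ a2 p1 * (h.χ a2 b1 * h.χ p2 b1) * (h.χ a2 q1 * h.χ p2 q1 * h.χ b2 q1)) •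
        (h.q4 a1 p1 b1 q1 ⊗ₜ[k] h.q4 a2 p2 b2 q2) := by
  simp only [q4, Δ_mul_S, Δ_mul_e, Δ_e, Sw_map, bm, TensorProduct.map_tmul,
    LinearMap.mulRight_apply, LinearMap.comp_apply, T_mul, T_S, T_e, map_smul,
    smul_mul_assoc, mul_smul_comm, smul_smul, TensorProduct.tmul_smul]
  refine h.Sw_congr fun _ _ => h.Sw_congr fun _ _ => h.Sw_congr fun _ _ =>
    h.Sw_congr fun _ _ => ?_
  congr 1; ring

lemma swap4 (i : ι) (f : ι → ι → ι → ι → M) :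
    (h.Sw i fun a b => h.Sw a fun a1 a2 => h.Sw b fun b1 b2 => f a1 a2 b1 b2) =
    h.Sw i fun a b => h.Sw a fun a1 a2 => h.Sw b fun b1 b2 => h.χ a2 b1 • f a1 b1 a2 b2 := by
  have E : ∀ g : ι → ι → ι → ι → M,
      (h.Sw i fun a b => h.Sw a fun a1 a2 => h.Sw b fun b1 b2 => g a1 a2 b1 b2) =
      h.Sw i fun a1 t => h.Sw t fun s b2 => h.Sw s fun a2 b1 => g a1 a2 b1 b2 := by
    intro g
    rw [h.coas i (fun a1 a2 b => h.Sw b fun b1 b2 => g a1 a2 b1 b2)]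
    refine h.Sw_congr fun a1 t => ?_
    rw [h.coas t (fun a2 b1 b2 => g a1 a2 b1 b2)]
  rw [E, E (fun a1 a2 b1 b2 => h.χ a2 b1 • f a1 b1 a2 b2)]
  refine h.Sw_congr fun a1 t => h.Sw_congr fun s b2 => ?_
  exact (h.coco s (fun a2 b1 => f a1 a2 b1 b2)).symm

lemma perm4 (a b p q : ι) (f : ι → ι → ι → ι → ι → ι → ι → ι → M) :
    (h.Sw q fun q1 q2 => h.Sw b fun b1 b2 => h.Sw p fun p1 p2 => h.Sw a fun a1 a2 =>
      f a1 a2 b1 b2 p1 p2 q1 q2) =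
    h.Sw a fun a1 a2 => h.Sw b fun b1 b2 => h.Sw p fun p1 p2 => h.Sw q fun q1 q2 =>
      f a1 a2 b1 b2 p1 p2 q1 q2 := by
  simp only [h.Sw_comm p a]
  simp only [h.Sw_comm b a]
  simp only [h.Sw_comm q a]
  simp only [h.Sw_comm q b]
  simp only [h.Sw_comm q p]

lemma perm4' (a b p q : ι) (f : ι → ι → ι → ι → ι → ι → ι → ι → M) :
    (h.Sw a fun a1 a2 => h.Sw p fun p1 p2 => h.Sw q fun q1 q2 => h.Sw b fun b1 b2 =>
      f a1 a2 b1 b2 p1 p2 q1 q2) =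
    h.Sw a fun a1 a2 => h.Sw b fun b1 b2 => h.Sw p fun p1 p2 => h.Sw q fun q1 q2 =>
      f a1 a2 b1 b2 p1 p2 q1 q2 := by
  simp only [h.Sw_comm q b]
  simp only [h.Sw_comm p b]

lemma lhsForm (i j : ι) : h.Δ (h.cm i j) =
    h.Sw i fun a b => h.Sw a fun a1 a2 => h.Sw b fun b1 b2 =>
      h.Sw j fun p q => h.Sw p fun p1 p2 => h.Sw q fun q1 q2 =>
      (h.χ b1 p1 * h.χ b2 p1 * h.χ b1 p2 * h.χ b2 p2 *
      (h.χ a2 p1 * (h.χ a2 b1 * h.χ p2 b1) * (h.χ a2 q1 * h.χ p2 q1 * h.χ b2 q1))) •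
        (h.q4 a1 p1 b1 q1 ⊗ₜ[k] h.q4 a2 p2 b2 q2) := by
  simp only [cm, Sw_map, map_smul, Δ_q4]
  refine h.Sw_congr fun a b => ?_
  have E : ∀ p q, (h.χ b p • (h.Sw q fun q1 q2 => h.Sw b fun b1 b2 => h.Sw p fun p1 p2 =>
      h.Sw a fun a1 a2 =>
      (h.χ a2 p1 * (h.χ a2 b1 * h.χ p2 b1) * (h.χ a2 q1 * h.χ p2 q1 * h.χ b2 q1)) •
        (h.q4 a1 p1 b1 q1 ⊗ₜ[k] h.q4 a2 p2 b2 q2))) =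
      h.Sw a fun a1 a2 => h.Sw b fun b1 b2 => h.Sw p fun p1 p2 => h.Sw q fun q1 q2 =>
      (h.χ b1 p1 * h.χ b2 p1 * h.χ b1 p2 * h.χ b2 p2 *
      (h.χ a2 p1 * (h.χ a2 b1 * h.χ p2 b1) * (h.χ a2 q1 * h.χ p2 q1 * h.χ b2 q1))) •
        (h.q4 a1 p1 b1 q1 ⊗ₜ[k] h.q4 a2 p2 b2 q2) := by
    intro p q
    rw [h.perm4 a b p q (fun a1 a2 b1 b2 p1 p2 q1 q2 =>
      (h.χ a2 p1 * (h.χ a2 b1 * h.χ p2 b1) * (h.χ a2 q1 * h.χ p2 q1 * h.χ b2 q1)) •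
        (h.q4 a1 p1 b1 q1 ⊗ₜ[k] h.q4 a2 p2 b2 q2)), Sw_smul]
    refine h.Sw_congr fun a1 a2 => ?_
    simp only [h.Sw_comm p q]
    simp only [h.Sw_comm b q]
    rw [Sw_smul]
    refine h.Sw_congr fun q1 q2 => ?_
    have := h.DS b p (fun p1 b1 b2 => h.χ a2 p1 * h.χ a2 q1 * (h.χ a2 b1 * h.χ b2 q1))
      (fun p1 b1 b2 p2 => h.χ p2 b1 * h.χ p2 q1)
      (fun p1 b1 b2 => (h.cL b1).mulc (h.cL q1))
      (fun p1 b2 p2 => (h.qR p2).mulc (QC.const h _))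
      (fun p1 b1 p2 => QC.const h _)
      (fun p1 b2 => (QC.const h _).mulc ((h.qR a2).mulc (QC.const h _)))
      (fun p1 b1 => (QC.const h _).mulc ((QC.const h _).mulc (h.qL q1)))
      ((TensorProduct.mk k A A).compl₁₂
        (LinearMap.mulRight k (h.S (h.e q1)) ∘ₗ LinearMap.mulLeft k (h.e a1))
        (LinearMap.mulRight k (h.S (h.e q2)) ∘ₗ LinearMap.mulLeft k (h.e a2)))
    simp only [LinearMap.compl₁₂_apply, TensorProduct.mk_apply, LinearMap.comp_apply,
      LinearMap.mulRight_apply, LinearMap.mulLeft_apply, ← mul_assoc (h.e _) (h.e _)] at this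
    simp only [Sw_smul]
    refine Eq.trans (h.Sw_congr fun b1 b2 => h.Sw_congr fun p1 p2 => ?_)
      (this.trans (h.Sw_congr fun b1 b2 => h.Sw_congr fun p1 p2 => ?_))
    · rw [smul_smul]; simp only [q4, mul_assoc]; congr 1; ring
    · simp only [q4, mul_assoc]; congr 1; ring
  rw [h.Sw_congr E, h.Sw_comm j a]
  refine h.Sw_congr fun a1 a2 => ?_
  rw [h.Sw_comm j b]

lemma rhsForm (i j : ι) :
    (h.Sw i fun a b => h.Sw j fun p q => h.χ b p • (h.cm a p ⊗ₜ[k] h.cm b q)) =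
    h.Sw i fun a b => h.Sw a fun a1 a2 => h.Sw b fun b1 b2 =>
      h.Sw j fun p q => h.Sw p fun p1 p2 => h.Sw q fun q1 q2 =>
      (h.χ b1 p1 * h.χ b2 p1 * h.χ b1 p2 * h.χ b2 p2 * (h.χ a2 p1 * h.χ b2 q1)) •
        (h.q4 a1 p1 a2 p2 ⊗ₜ[k] h.q4 b1 q1 b2 q2) := by
  refine h.Sw_congr fun a b => ?_
  have E : ∀ p q, h.χ b p • (h.cm a p ⊗ₜ[k] h.cm b q) =
      h.Sw a fun a1 a2 => h.Sw b fun b1 b2 => h.Sw p fun p1 p2 => h.Sw q fun q1 q2 =>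
      (h.χ b1 p1 * h.χ b2 p1 * h.χ b1 p2 * h.χ b2 p2 * (h.χ a2 p1 * h.χ b2 q1)) •
        (h.q4 a1 p1 a2 p2 ⊗ₜ[k] h.q4 b1 q1 b2 q2) := by
    intro p q
    have e1 : h.χ b p • (h.cm a p ⊗ₜ[k] h.cm b q) =
      h.Sw a fun a1 a2 => h.Sw p fun p1 p2 => h.Sw q fun q1 q2 => h.Sw b fun b1 b2 =>
        (h.χ b p * (h.χ a2 p1 * h.χ b2 q1)) •
        (h.q4 a1 p1 a2 p2 ⊗ₜ[k] h.q4 b1 q1 b2 q2) := by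
      simp only [cm, Sw_tmulR, Sw_smul]
      simp only [Sw_tmulL, Sw_smul, h.Sw_comm b q, TensorProduct.smul_tmul', smul_smul,
        TensorProduct.tmul_smul]
      refine h.Sw_congr fun a1 a2 => h.Sw_congr fun p1 p2 => h.Sw_congr fun q1 q2 =>
        h.Sw_congr fun b1 b2 => ?_
      rw [mul_comm (h.χ b2 q1)]
    have e2 : ∀ a1 a2 p1 p2 q1 q2, (h.Sw b fun b1 b2 =>
        (h.χ b p * (h.χ a2 p1 * h.χ b2 q1)) •
        (h.q4 a1 p1 a2 p2 ⊗ₜ[k] h.q4 b1 q1 b2 q2)) =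
        h.Sw b fun b1 b2 => (h.χ b1 p * h.χ b2 p * (h.χ a2 p1 * h.χ b2 q1)) •
        (h.q4 a1 p1 a2 p2 ⊗ₜ[k] h.q4 b1 q1 b2 q2) := by
      intro a1 a2 p1 p2 q1 q2
      have := h.F2' p b (fun _ => h.e q1) (fun b1 b2 => h.χ a2 p1 * h.χ b2 q1)
        (fun b1 => (QC.const h _).mulc (h.qL q1)) (fun b1 =>
          (TensorProduct.mk k A A (h.q4 a1 p1 a2 p2)) ∘ₗ LinearMap.mulRight k (h.S (h.e q2)))
      simpa [q4] using this
    rw [e1]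
    simp only [e2]
    rw [h.perm4' a b p q (fun a1 a2 b1 b2 p1 p2 q1 q2 =>
      (h.χ b1 p * h.χ b2 p * (h.χ a2 p1 * h.χ b2 q1)) •
        (h.q4 a1 p1 a2 p2 ⊗ₜ[k] h.q4 b1 q1 b2 q2))]
    refine h.Sw_congr fun a1 a2 => h.Sw_congr fun b1 b2 => ?_
    rw [h.Sw_comm p q, h.Sw_comm p q]
    refine h.Sw_congr fun q1 q2 => ?_
    have f1 := h.F2 b1 p (fun _ => h.S (h.e a2)) (fun p1 p2 => h.χ b2 p * (h.χ a2 p1 * h.χ b2 q1))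
        (fun _ => (QC.const h _)) (fun p1 =>
          (TensorProduct.mk k A A).flip (h.q4 b1 q1 b2 q2) ∘ₗ LinearMap.mulLeft k (h.e a1))
    have f2 := h.F2 b2 p (fun _ => h.S (h.e a2))
        (fun p1 p2 => h.χ b1 p1 * (h.χ a2 p1 * h.χ b2 q1) * h.χ b1 p2)
        (fun _ => (QC.const h _).mulc (h.qR b1)) (fun p1 =>
          (TensorProduct.mk k A A).flip (h.q4 b1 q1 b2 q2) ∘ₗ LinearMap.mulLeft k (h.e a1))
    simp only [LinearMap.comp_apply, LinearMap.mulLeft_apply, LinearMap.flip_apply,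
      TensorProduct.mk_apply] at f1 f2
    refine Eq.trans (h.Sw_congr fun p1 p2 => ?_) (f1.trans (Eq.trans (h.Sw_congr fun p1 p2 => ?_)
      (f2.trans (h.Sw_congr fun p1 p2 => ?_))))
    · simp only [q4, mul_assoc]
    · congr 1; ring
    · simp only [q4, mul_assoc]; congr 1; ring
  rw [h.Sw_congr E, h.Sw_comm j a]
  refine h.Sw_congr fun a1 a2 => ?_
  rw [h.Sw_comm j b]

theorem Δ_cm (i j : ι) : h.Δ (h.cm i j) =
    h.Sw i fun a b => h.Sw j fun p q => h.χ b p • (h.cm a p ⊗ₜ[k] h.cm b q) := by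
  rw [lhsForm, rhsForm]
  rw [h.swap4 i (fun a1 a2 b1 b2 => h.Sw j fun p q => h.Sw p fun p1 p2 => h.Sw q fun q1 q2 =>
      (h.χ b1 p1 * h.χ b2 p1 * h.χ b1 p2 * h.χ b2 p2 * (h.χ a2 p1 * h.χ b2 q1)) •
        (h.q4 a1 p1 a2 p2 ⊗ₜ[k] h.q4 b1 q1 b2 q2))]
  refine h.Sw_congr fun a b => h.Sw_congr fun a1 a2 => h.Sw_congr fun b1 b2 => ?_
  rw [h.swap4 j (fun p1 p2 q1 q2 =>
      (h.χ a2 p1 * h.χ b2 p1 * h.χ a2 p2 * h.χ b2 p2 * (h.χ b1 p1 * h.χ b2 q1)) •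
        (h.q4 a1 p1 b1 p2 ⊗ₜ[k] h.q4 a2 q1 b2 q2)), Sw_smul]
  refine h.Sw_congr fun p q => ?_
  simp only [Sw_smul, smul_smul]
  refine h.Sw_congr fun p1 p2 => h.Sw_congr fun q1 q2 => ?_
  congr 1
  linear_combination (h.χ b1 p1 * h.χ b2 p1 * h.χ b2 p2 * h.χ a2 p1 * h.χ a2 b1 *
    (h.χ a2 q1 * h.χ p2 q1 * h.χ b2 q1)) * h.χ_swap b1 p2

theorem T_cm (m i j : ι) : h.T m (h.cm i j) = (h.χ i m * h.χ j m) • h.cm i j := by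
  simp only [cm, Sw_map, map_smul, q4, T_mul, T_S, T_e, smul_mul_assoc, mul_smul_comm, smul_smul,
    Sw_smul]
  have f1 : ∀ p q, _ := fun p q => h.F2' m i (fun _ => h.e p)
    (fun a b => h.χ j m * h.χ b p) (fun a => (QC.const h _).mulc (h.qL p))
    (fun a => LinearMap.mulRight k (h.S (h.e q)))
  have f1' := h.Sw_congr (i := j) f1
  have f2 : ∀ a b, _ := fun a b => h.F2' m j (fun _ => h.S (h.e b))
    (fun p q => h.χ a m * h.χ b m * h.χ b p) (fun p => QC.const h _)
    (fun p => LinearMap.mulLeft k (h.e a))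
  have f2' := h.Sw_congr (i := i) f2
  simp only [LinearMap.mulLeft_apply, LinearMap.mulRight_apply] at f1' f2'
  rw [h.Sw_comm j i, h.Sw_comm j i] at f1'
  refine Eq.trans (h.Sw_congr fun p1 p2 => h.Sw_congr fun _ _ => ?_)
    (f2'.symm.trans (Eq.trans (h.Sw_congr fun p1 p2 => h.Sw_congr fun _ _ => ?_)
      (f1'.symm.trans (h.Sw_congr fun p1 p2 => h.Sw_congr fun _ _ => ?_))))
  · simp only [mul_assoc]; congr 1; ring
  · simp only [mul_assoc]; congr 1; ring
  · congr 1; ring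

end HD
end Abstract

section Inst
variable {k G A ι : Type*} [Field k] [CommGroup G] [Ring A] [Algebra k A]
  (C : ColorHopfAlg k G A)

lemma exists_hbasis : ∃ (s : Set A) (e : Module.Basis s k A) (d : s → G),
    ∀ i, e i ∈ C.grade (d i) := by
  have hs : ⊤ ≤ Submodule.span k {x : A | ∃ g, x ∈ C.grade g} := by
    rw [← C.grade_top]
    exact iSup_le fun g x hx => Submodule.subset_span ⟨g, hx⟩
  let e := Module.Basis.ofSpan hs
  have : ∀ i, ∃ g, e i ∈ C.grade g := fun i =>
    Module.Basis.ofSpan_subset hs ⟨i, rfl⟩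
  choose d hd using this
  exact ⟨_, e, d, hd⟩

lemma swOf_Δ {M : Type*} [AddCommGroup M] [Module k M] (e : Module.Basis ι k A)
    (Δ : A →ₗ[k] A ⊗[k] A) (L : A ⊗[k] A →ₗ[k] M) (i : ι) :
    L (Δ (e i)) = swOf e Δ i fun a b => L (e a ⊗ₜ e b) := by
  conv_lhs => rw [← (e.tensorProduct e).linearCombination_repr (Δ (e i))]
  simp [swOf, Finsupp.linearCombination_apply, Finsupp.sum,
    Module.Basis.tensorProduct_apply']

lemma φ_one_left (g : G) : C.φ 1 g = 1 := by
  have := C.φ_mul_left 1 1 g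
  rw [mul_one] at this
  exact (mul_eq_left₀ (C.φ_ne 1 g)).1 this.symm

lemma φ_one_right (g : G) : C.φ g 1 = 1 := by
  have := C.φ_mul_right g 1 1
  rw [mul_one] at this
  exact (mul_eq_left₀ (C.φ_ne g 1)).1 this.symm

variable (e : Module.Basis ι k A) (d : ι → G)

lemma braid_dgL (hd : ∀ i, e i ∈ C.grade (d i))
    (m : ι) (x : A) :
    C.braid (x ⊗ₜ e m) = e m ⊗ₜ dgOf e (fun i => C.φ (d i) (d m)) x := by
  have : C.braid ∘ₗ (TensorProduct.mk k A A).flip (e m) =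
      TensorProduct.mk k A A (e m) ∘ₗ dgOf e (fun i => C.φ (d i) (d m)) := by
    apply e.ext; intro i
    simp [dgOf, C.braid_apply _ _ _ _ (hd i) (hd m)]
  exact LinearMap.congr_fun this x

lemma braid_dgR (hd : ∀ i, e i ∈ C.grade (d i))
    (m : ι) (x : A) :
    C.braid (e m ⊗ₜ x) = dgOf e (fun i => C.φ (d m) (d i)) x ⊗ₜ e m := by
  have : C.braid ∘ₗ (TensorProduct.mk k A A) (e m) =
      (TensorProduct.mk k A A).flip (e m) ∘ₗ dgOf e (fun i => C.φ (d m) (d i)) := by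
    apply e.ext; intro i
    simp [dgOf, C.braid_apply _ _ _ _ (hd m) (hd i), TensorProduct.smul_tmul']
  exact LinearMap.congr_fun this x

lemma tinjL (m : ι) {x y : A} (h : e m ⊗ₜ[k] x = e m ⊗ₜ[k] y) : x = y := by
  have := congrArg ((TensorProduct.lid k A).toLinearMap ∘ₗ
    TensorProduct.map (e.coord m) LinearMap.id) h
  simpa using this

lemma tinjR (m : ι) {x y : A} (h : x ⊗ₜ[k] e m = y ⊗ₜ[k] e m) : x = y := by
  have := congrArg ((TensorProduct.rid k A).toLinearMap ∘ₗ
    TensorProduct.map LinearMap.id (e.coord m)) h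
  simpa using this

lemma dgL_apply (hd : ∀ i, e i ∈ C.grade (d i))
    (m : ι) (g : G) (x : A) (hx : x ∈ C.grade g) :
    dgOf e (fun i => C.φ (d i) (d m)) x = C.φ g (d m) • x := by
  apply tinjL e m
  rw [← braid_dgL C e d hd, C.braid_apply _ _ _ _ hx (hd m), TensorProduct.tmul_smul]

lemma dgR_apply (hd : ∀ i, e i ∈ C.grade (d i))
    (m : ι) (g : G) (x : A) (hx : x ∈ C.grade g) :
    dgOf e (fun i => C.φ (d m) (d i)) x = C.φ (d m) g • x := by
  apply tinjR e m
  rw [← braid_dgR C e d hd, C.braid_apply _ _ _ _ (hd m) hx, TensorProduct.smul_tmul']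

lemma isCharOf_mk (hd : ∀ i, e i ∈ C.grade (d i))
    (hm : ∀ x y, C.mul (x ⊗ₜ y) = x * y)
    (h1 : C.one = 1)
    (τ : ι → k) (f : G → k) (f0 : ∀ g, f g ≠ 0) (f1 : f 1 = 1)
    (fm : ∀ g g', f (g * g') = f g * f g') (hτ : ∀ i, τ i = f (d i))
    (hf : ∀ g x, x ∈ C.grade g → dgOf e τ x = f g • x) : IsCharOf e C.antipode τ := by
  refine ⟨fun i => hτ i ▸ f0 _, ?_, ?_, ?_⟩
  · have : (LinearMap.mul k A).compr₂ (dgOf e τ) =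
        (LinearMap.mul k A).compl₁₂ (dgOf e τ) (dgOf e τ) := by
      refine e.ext fun i => e.ext fun j => ?_
      have := hf _ _ (C.mul_mem _ _ _ _ (hd i) (hd j))
      simp only [LinearMap.compr₂_apply, LinearMap.compl₁₂_apply, LinearMap.mul_apply']
      rw [hm] at this
      rw [this, hf _ _ (hd i), hf _ _ (hd j), fm, smul_mul_smul_comm]
    intro x y
    exact LinearMap.congr_fun₂ this x y
  · have : dgOf e τ ∘ₗ C.antipode = C.antipode ∘ₗ dgOf e τ := by
      refine e.ext fun i => ?_
      simp only [LinearMap.comp_apply]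
      rw [hf _ _ (hd i), hf _ _ (C.antipode_mem _ _ (hd i)), map_smul]
    exact fun x => LinearMap.congr_fun this x
  · have := hf _ _ C.one_mem
    rwa [h1, f1, one_smul] at this

lemma mul_eq_mul' (hm : ∀ x y, C.mul (x ⊗ₜ y) = x * y)
    : C.mul = LinearMap.mul' k A := by
  ext x y; simp [hm]

/-- the index form of a color Hopf algebra -/
noncomputable def mkHD (hd : ∀ i, e i ∈ C.grade (d i))
    (hm : ∀ x y, C.mul (x ⊗ₜ y) = x * y) (h1 : C.one = 1) : HD k ι A where
  e := e
  Δ := C.comul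
  ε := C.counit
  S := C.antipode
  χ i j := C.φ (d i) (d j)
  χ_swap i j := C.φ_skew _ _
  chL m := isCharOf_mk C e d hd hm h1 _ (fun g => C.φ g (d m)) (fun _ => C.φ_ne _ _)
    (φ_one_left C _) (fun _ _ => C.φ_mul_left _ _ _) (fun _ => rfl) (dgL_apply C e d hd m)
  chR m := isCharOf_mk C e d hd hm h1 _ (fun g => C.φ (d m) g) (fun _ => C.φ_ne _ _)
    (φ_one_right C _) (fun _ _ => C.φ_mul_right _ _ _) (fun _ => rfl) (dgR_apply C e d hd m)
  coassoc := C.coassoc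
  counit_left := C.counit_left
  counit_right := C.counit_right
  comul_one := by rw [← h1, C.comul_one]
  counit_one := by rw [← h1, C.counit_one]
  counit_mul x y := by rw [← hm, C.counit_mul]
  comul_mul i j := by
    have := LinearMap.congr_fun C.comul_mul (e i ⊗ₜ e j)
    simp only [LinearMap.comp_apply, hm, TensorProduct.map_tmul] at this
    rw [this]
    refine (swOf_Δ e C.comul (TensorProduct.map C.mul C.mul ∘ₗ midMap k C.braid ∘ₗ
      (TensorProduct.mk k _ _).flip (C.comul (e j))) i).trans ?_
    congr 1; funext a b
    refine (swOf_Δ e C.comul (TensorProduct.map C.mul C.mul ∘ₗ midMap k C.braid ∘ₗ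
      (TensorProduct.mk k _ _) (e a ⊗ₜ e b)) j).trans ?_
    congr 1; funext p q
    simp [midMap, C.braid_apply _ _ _ _ (hd b) (hd p), hm, TensorProduct.smul_tmul']
  cocomm i := by
    have := LinearMap.congr_fun C.cocomm (e i)
    rw [LinearMap.comp_apply, swOf_Δ] at this
    rw [← this]
    congr 1; funext a b
    rw [C.braid_apply _ _ _ _ (hd a) (hd b)]
  antipode_left x := by rw [← mul_eq_mul' C hm, C.antipode_left, h1]
  antipode_right x := by rw [← mul_eq_mul' C hm, C.antipode_right, h1]

lemma commMap_e (hd : ∀ i, e i ∈ C.grade (d i))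
    (hm : ∀ x y, C.mul (x ⊗ₜ y) = x * y)
    (h1 : C.one = 1)
    (i j : ι) : C.commMap (e i ⊗ₜ[k] e j) = (mkHD C e d hd hm h1).cm i j := by
  set h := mkHD C e d hd hm h1 with hh
  have he : h.e = e := rfl
  have hΔ : h.Δ = C.comul := rfl
  have hS : h.S = C.antipode := rfl
  have hb : ∀ i j, C.braid (h.e i ⊗ₜ h.e j) = h.χ i j • (h.e j ⊗ₜ h.e i) := fun i j =>
    C.braid_apply _ _ _ _ (hd i) (hd j)
  have hadj : ∀ i j, C.adj (h.e i ⊗ₜ h.e j) =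
      h.Sw i fun a b => h.χ b j • (h.e a * h.e j * h.S (h.e b)) := by
    intro i j
    simp only [ColorHopfAlg.adj, LinearMap.comp_apply, TensorProduct.map_tmul, ← hΔ, ← hS,
      LinearMap.id_apply, h.Δ_e, h.Sw_tmulR, h.Sw_map, LinearEquiv.coe_coe, h.Sw_mapE,
      TensorProduct.assoc_tmul, hb, map_smul, hm, TensorProduct.tmul_smul, mul_assoc]
  have hcm : ∀ i j, C.commMap (h.e i ⊗ₜ h.e j) = h.cm i j := by
    intro i j
    rw [HD.cm, h.Sw_comm i j]
    simp only [ColorHopfAlg.commMap, LinearMap.comp_apply, TensorProduct.map_tmul, ← hΔ, ← hS,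
      LinearMap.id_apply, h.Δ_e, h.Sw_tmulL, h.Sw_map, LinearEquiv.coe_coe, h.Sw_mapE,
      TensorProduct.assoc_symm_tmul, hadj, map_smul, hm, h.Sw_mulR, smul_mul_assoc, HD.q4]
  exact hcm i j

lemma comul_commMap (hd : ∀ i, e i ∈ C.grade (d i))
    (hm : ∀ x y, C.mul (x ⊗ₜ y) = x * y)
    (h1 : C.one = 1)
    (x y : A) : C.comul (C.commMap (x ⊗ₜ[k] y)) =
        (TensorProduct.map C.commMap C.commMap) (C.comul2 (x ⊗ₜ[k] y)) := by
  set h := mkHD C e d hd hm h1 with hh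
  have he : h.e = e := rfl
  have hΔ : h.Δ = C.comul := rfl
  have hS : h.S = C.antipode := rfl
  have hb : ∀ i j, C.braid (h.e i ⊗ₜ h.e j) = h.χ i j • (h.e j ⊗ₜ h.e i) := fun i j =>
    C.braid_apply _ _ _ _ (hd i) (hd j)
  have hcm : ∀ i j, C.commMap (h.e i ⊗ₜ h.e j) = h.cm i j := commMap_e C e d hd hm h1
  have : C.comul ∘ₗ C.commMap = (TensorProduct.map C.commMap C.commMap) ∘ₗ C.comul2 := by
    refine (h.e.tensorProduct h.e).ext fun ⟨i, j⟩ => ?_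
    rw [Module.Basis.tensorProduct_apply]
    simp only [LinearMap.comp_apply, hcm, ← hΔ, h.Δ_cm]
    simp only [ColorHopfAlg.comul2, midMap, LinearMap.comp_apply, TensorProduct.map_tmul, ← hΔ,
      LinearMap.id_apply, h.Δ_e, h.Sw_tmulL, h.Sw_tmulR, h.Sw_map, LinearEquiv.coe_coe, h.Sw_mapE,
      TensorProduct.assoc_symm_tmul, TensorProduct.assoc_tmul, hb, map_smul, hcm,
      TensorProduct.tmul_smul, ← TensorProduct.smul_tmul', h.Sw_comm i j]
  exact LinearMap.congr_fun this (x ⊗ₜ y)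

end Inst

section Part2
variable {k G A ι : Type*} [Field k] [CommGroup G] [Ring A] [Algebra k A]
  (C : ColorHopfAlg k G A)

lemma midMap_pure (c : A ⊗[k] A →ₗ[k] A ⊗[k] A) (a b p q : A) (r : k)
    (hr : c (b ⊗ₜ p) = r • (p ⊗ₜ b)) :
    midMap k c ((a ⊗ₜ b) ⊗ₜ (p ⊗ₜ q)) = r • ((a ⊗ₜ p) ⊗ₜ (b ⊗ₜ q)) := by
  simp [midMap, hr, ← TensorProduct.smul_tmul']

lemma range_map_eq (N : Submodule k A) (S : Set A) (hN : N = Submodule.span k S) :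
    LinearMap.range (TensorProduct.map N.subtype N.subtype) =
      Submodule.span k (Set.image2 (fun a b => a ⊗ₜ[k] b) S S) := by
  have h2 : LinearMap.range (TensorProduct.map N.subtype N.subtype) =
      Submodule.map₂ (TensorProduct.mk k A A) N N := by
    apply le_antisymm
    · rintro _ ⟨u, rfl⟩
      induction u with
      | zero => simp
      | add x y hx hy => rw [map_add]; exact add_mem hx hy
      | tmul x y => exact Submodule.apply_mem_map₂ _ x.2 y.2
    · rw [Submodule.map₂_le]
      intro x hx y hy
      exact ⟨(⟨x, hx⟩ : N) ⊗ₜ (⟨y, hy⟩ : N), rfl⟩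
  rw [h2, hN, Submodule.map₂_span_span]
  rfl

/-- bilinear span argument -/
lemma bil_mem {X Y Z : Type*} [AddCommGroup X] [Module k X] [AddCommGroup Y] [Module k Y]
    [AddCommGroup Z] [Module k Z] (F : X ⊗[k] Y →ₗ[k] Z) (s : Set X) (t : Set Y)
    (P : Submodule k Z) (hF : ∀ x ∈ s, ∀ y ∈ t, F (x ⊗ₜ y) ∈ P) {x : X} {y : Y}
    (hx : x ∈ Submodule.span k s) (hy : y ∈ Submodule.span k t) : F (x ⊗ₜ y) ∈ P := by
  have := Submodule.apply_mem_map₂ (TensorProduct.curry F) hx hy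
  rw [Submodule.map₂_span_span] at this
  refine (Submodule.span_le.2 ?_) this
  rintro _ ⟨a, ha, b, hb, rfl⟩
  exact hF a ha b hb

lemma repr_dg (e : Module.Basis ι k A) (τ : ι → k) (z : A) (n : ι) :
    e.repr (dgOf e τ z) n = τ n * e.repr z n := by
  have : e.coord n ∘ₗ dgOf e τ = τ n • e.coord n := by
    classical
    apply e.ext; intro i
    simp only [dgOf, LinearMap.comp_apply, Module.Basis.constr_basis, map_smul,
      Module.Basis.coord_apply, Module.Basis.repr_self, LinearMap.smul_apply, smul_eq_mul,
      Finsupp.single_apply]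
    split_ifs with hh
    · rw [hh]
    · simp
  simpa using LinearMap.congr_fun this z

/-- quasi-homogeneous elements -/
def QH (e : Module.Basis ι k A) (d : ι → G) (z : A) : Prop :=
  ∀ m, ∃ c : k, dgOf e (fun i => C.φ (d i) (d m)) z = c • z

variable (e : Module.Basis ι k A) (d : ι → G)

lemma QH.braid (hd : ∀ i, e i ∈ C.grade (d i))
    {z w : A} (hz : QH C e d z) (hw : QH C e d w) :
    ∃ c : k, C.braid (z ⊗ₜ w) = c • (w ⊗ₜ z) := by
  by_cases z0 : z = 0
  · exact ⟨0, by simp [z0]⟩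
  obtain ⟨n, hn⟩ : ∃ n, e.repr z n ≠ 0 := by
    by_contra! hcon
    exact z0 (e.repr.injective (by ext i; simp [hcon i]))
  have hT : ∀ m, dgOf e (fun i => C.φ (d i) (d m)) z = C.φ (d n) (d m) • z := by
    intro m
    obtain ⟨c, hc⟩ := hz m
    have h2 := repr_dg e (fun i => C.φ (d i) (d m)) z n
    rw [hc, map_smul, Finsupp.smul_apply, smul_eq_mul] at h2
    rw [hc, mul_right_cancel₀ hn h2]
  have hb : C.braid (z ⊗ₜ w) = dgOf e (fun i => C.φ (d n) (d i)) w ⊗ₜ z := by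
    have : C.braid ∘ₗ (TensorProduct.mk k A A) z =
        (TensorProduct.mk k A A).flip z ∘ₗ dgOf e (fun i => C.φ (d n) (d i)) := by
      apply e.ext; intro m
      simp only [LinearMap.comp_apply, TensorProduct.mk_apply, LinearMap.flip_apply]
      rw [braid_dgL C e d hd, hT]
      simp [dgOf, TensorProduct.smul_tmul']
    exact LinearMap.congr_fun this w
  obtain ⟨c, hc⟩ := hw n
  have hUT : dgOf e (fun i => C.φ (d n) (d i)) (dgOf e (fun i => C.φ (d i) (d n)) w) = w := by
    have : dgOf e (fun i => C.φ (d n) (d i)) ∘ₗ dgOf e (fun i => C.φ (d i) (d n)) =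
        LinearMap.id := by
      apply e.ext; intro i
      simp [dgOf, smul_smul, C.φ_skew]
    exact LinearMap.congr_fun this w
  rw [hc, map_smul] at hUT
  refine ⟨c⁻¹, ?_⟩
  rw [hb]
  by_cases c0 : c = 0
  · have : w = 0 := by rw [← hUT, c0, zero_smul]
    simp [this]
  · have : dgOf e (fun i => C.φ (d n) (d i)) w = c⁻¹ • w := by
      rw [eq_inv_smul_iff₀ c0, hUT]
    rw [this, TensorProduct.smul_tmul']

lemma QH.homog (hd : ∀ i, e i ∈ C.grade (d i))
    {g : G} {x : A} (hx : x ∈ C.grade g) : QH C e d x :=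
  fun m => ⟨_, dgL_apply C e d hd m g x hx⟩

lemma QH.mul (hd : ∀ i, e i ∈ C.grade (d i))
    (hm : ∀ x y, C.mul (x ⊗ₜ y) = x * y)
    (h1 : C.one = 1)
    {z w : A} (hz : QH C e d z) (hw : QH C e d w) : QH C e d (z * w) := by
  intro m
  obtain ⟨a, ha⟩ := hz m
  obtain ⟨b, hb⟩ := hw m
  have := (mkHD C e d hd hm h1).T_mul m z w
  change dgOf e (fun i => C.φ (d i) (d m)) (z * w) = dgOf e (fun i => C.φ (d i) (d m)) z *
    dgOf e (fun i => C.φ (d i) (d m)) w at this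
  exact ⟨a * b, by rw [this, ha, hb, smul_mul_smul_comm]⟩

lemma QH.comm (hd : ∀ i, e i ∈ C.grade (d i))
    (hm : ∀ x y, C.mul (x ⊗ₜ y) = x * y)
    (h1 : C.one = 1)
    {z w : A} (hz : QH C e d z) (hw : QH C e d w) :
    QH C e d (C.commMap (z ⊗ₜ w)) := by
  intro m
  obtain ⟨a, ha⟩ := hz m
  obtain ⟨b, hb⟩ := hw m
  have : dgOf e (fun i => C.φ (d i) (d m)) ∘ₗ C.commMap = C.commMap ∘ₗ
      TensorProduct.map (dgOf e (fun i => C.φ (d i) (d m)))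
        (dgOf e (fun i => C.φ (d i) (d m))) := by
    refine (e.tensorProduct e).ext fun ⟨i, j⟩ => ?_
    rw [Module.Basis.tensorProduct_apply]
    have := (mkHD C e d hd hm h1).T_cm m i j
    rw [← commMap_e C e d hd hm h1] at this
    refine this.trans ?_
    simp only [mkHD, dgOf, TensorProduct.map_tmul, LinearMap.comp_apply,
      Module.Basis.constr_basis, TensorProduct.smul_tmul_smul, map_smul]
  have := LinearMap.congr_fun this (z ⊗ₜ w)
  simp only [LinearMap.comp_apply, TensorProduct.map_tmul, ha, hb,
    TensorProduct.smul_tmul_smul, map_smul] at this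
  exact ⟨_, this⟩

lemma part2 (hd : ∀ i, e i ∈ C.grade (d i))
    (hm : ∀ x y, C.mul (x ⊗ₜ y) = x * y)
    (h1 : C.one = 1)
    (V W : Submodule k A) (hV : C.IsCHSub V) (hW : C.IsCHSub W) :
    ∀ z ∈ C.commSub V W,
      C.comul z ∈ LinearMap.range
        (TensorProduct.map (C.commSub V W).subtype (C.commSub V W).subtype) := by
  set N := C.commSub V W with hN
  have N1 : C.one ∈ N := Submodule.mem_sInf.2 fun P hP => hP.2.1
  have Nm : ∀ x ∈ N, ∀ y ∈ N, C.mul (x ⊗ₜ y) ∈ N := fun x hx y hy =>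
    Submodule.mem_sInf.2 fun P hP =>
      hP.2.2 x (Submodule.mem_sInf.1 hx P hP) y (Submodule.mem_sInf.1 hy P hP)
  have Ng : ∀ x ∈ V, ∀ y ∈ W, C.commMap (x ⊗ₜ y) ∈ N := fun x hx y hy =>
    Submodule.mem_sInf.2 fun P hP => hP.1 ⟨x, hx, y, hy, rfl⟩
  have Nle : ∀ P : Submodule k A, (∀ x ∈ V, ∀ y ∈ W, C.commMap (x ⊗ₜ y) ∈ P) → C.one ∈ P →
      (∀ x ∈ P, ∀ y ∈ P, C.mul (x ⊗ₜ y) ∈ P) → N ≤ P := fun P h1 h2 h3 =>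
    sInf_le ⟨by rintro _ ⟨x, hx, y, hy, rfl⟩; exact h1 x hx y hy, h2, h3⟩
  set SV : Set A := {y : A | y ∈ V ∧ ∃ g : G, y ∈ C.grade g} with hSV
  set SW : Set A := {y : A | y ∈ W ∧ ∃ g : G, y ∈ C.grade g} with hSW
  set S : Set A := {z | z ∈ N ∧ QH C e d z} with hS
  have VS : V = Submodule.span k SV :=
    le_antisymm hV.graded (Submodule.span_le.2 fun _ h => h.1)
  have WS : W = Submodule.span k SW :=
    le_antisymm hW.graded (Submodule.span_le.2 fun _ h => h.1)
  have gS : ∀ x ∈ SV, ∀ y ∈ SW, C.commMap (x ⊗ₜ y) ∈ S := by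
    rintro x ⟨hx, g, hg⟩ y ⟨hy, g', hg'⟩
    exact ⟨Ng x hx y hy, QH.comm C e d hd hm h1 (QH.homog C e d hd hg) (QH.homog C e d hd hg')⟩
  have NS : N = Submodule.span k S := by
    refine le_antisymm (Nle _ ?_ ?_ ?_) (Submodule.span_le.2 fun _ h => h.1)
    · intro x hx y hy
      exact bil_mem C.commMap SV SW _ (fun x hx y hy => Submodule.subset_span (gS x hx y hy))
        (VS ▸ hx) (WS ▸ hy)
    · exact Submodule.subset_span ⟨N1, QH.homog C e d hd C.one_mem⟩
    · intro x hx y hy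
      refine bil_mem C.mul S S _ ?_ hx hy
      intro x hx y hy
      refine Submodule.subset_span ⟨Nm x hx.1 y hy.1, ?_⟩
      rw [hm]
      exact QH.mul C e d hd hm h1 hx.2 hy.2
  have RV := range_map_eq V SV VS
  have RW := range_map_eq W SW WS
  have RN := range_map_eq N S NS
  set R := LinearMap.range (TensorProduct.map N.subtype N.subtype) with hR
  have hRm : ∀ a ∈ S, ∀ b ∈ S, a ⊗ₜ[k] b ∈ R := fun a ha b hb => by
    rw [RN]; exact Submodule.subset_span ⟨a, ha, b, hb, rfl⟩
  refine Nle (Submodule.comap C.comul R) ?_ ?_ ?_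
  · intro x hx y hy
    rw [Submodule.mem_comap, comul_commMap C e d hd hm h1]
    have hx2 := hV.comul_mem x hx
    have hy2 := hW.comul_mem y hy
    rw [RV] at hx2
    rw [RW] at hy2
    refine bil_mem ((TensorProduct.map C.commMap C.commMap) ∘ₗ midMap k C.braid) _ _ R ?_ hx2 hy2
    rintro _ ⟨a, ha, b, hb, rfl⟩ _ ⟨p, hp, q, hq, rfl⟩
    obtain ⟨g, hg⟩ := hb.2
    obtain ⟨g', hg'⟩ := hp.2
    rw [LinearMap.comp_apply, midMap_pure _ _ _ _ _ _ (C.braid_apply _ _ _ _ hg hg'), map_smul,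
      TensorProduct.map_tmul]
    exact R.smul_mem _ (hRm _ (gS a ha p hp) _ (gS b hb q hq))
  · rw [Submodule.mem_comap, C.comul_one]
    have : C.one ∈ S := ⟨N1, QH.homog C e d hd C.one_mem⟩
    exact hRm _ this _ this
  · intro x hx y hy
    rw [Submodule.mem_comap, RN] at hx hy
    have := LinearMap.congr_fun C.comul_mul (x ⊗ₜ y)
    rw [LinearMap.comp_apply] at this
    rw [Submodule.mem_comap, this]
    refine bil_mem ((TensorProduct.map C.mul C.mul) ∘ₗ midMap k C.braid) _ _ R ?_ hx hy
    rintro _ ⟨a, ha, b, hb, rfl⟩ _ ⟨p, hp, q, hq, rfl⟩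
    obtain ⟨c, hc⟩ := QH.braid C e d hd hb.2 hp.2
    rw [LinearMap.comp_apply, midMap_pure _ _ _ _ _ _ hc, map_smul, TensorProduct.map_tmul]
    refine R.smul_mem _ (hRm _ ⟨Nm _ ha.1 _ hp.1, ?_⟩ _ ⟨Nm _ hb.1 _ hq.1, ?_⟩)
    · rw [hm]; exact QH.mul C e d hd hm h1 ha.2 hp.2
    · rw [hm]; exact QH.mul C e d hd hm h1 hb.2 hq.2

lemma ringForm (hm : ∀ x y, C.mul (x ⊗ₜ y) = x * y)
    (h1 : C.one = 1)
    (V W : Submodule k A) (hV : C.IsCHSub V) (hW : C.IsCHSub W) :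
    (∀ x ∈ V, ∀ y ∈ W,
      C.comul (C.commMap (x ⊗ₜ[k] y)) =
        (TensorProduct.map C.commMap C.commMap) (C.comul2 (x ⊗ₜ[k] y))) ∧
    (∀ z ∈ C.commSub V W,
      C.comul z ∈ LinearMap.range
        (TensorProduct.map (C.commSub V W).subtype (C.commSub V W).subtype)) := by
  obtain ⟨s, e, d, hd⟩ := exists_hbasis C
  exact ⟨fun x _ y _ => comul_commMap C e d hd hm h1 x y, part2 C e d hd hm h1 V W hV hW⟩

end Part2

section Transfer
variable {k G H : Type*} [Field k] [CommGroup G] [iH : AddCommGroup H] [Module k H]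

/-- the ring structure underlying a color Hopf algebra -/
@[reducible] def toRingOf (C : ColorHopfAlg k G H) : Ring H :=
  { iH with
    mul := fun x y => C.mul (x ⊗ₜ y)
    one := C.one
    mul_assoc := C.mul_assoc'
    one_mul := C.one_mul'
    mul_one := C.mul_one'
    left_distrib := fun x y z => by
      change C.mul (x ⊗ₜ (y + z)) = C.mul (x ⊗ₜ y) + C.mul (x ⊗ₜ z)
      rw [TensorProduct.tmul_add, map_add]
    right_distrib := fun x y z => by
      change C.mul ((x + y) ⊗ₜ z) = C.mul (x ⊗ₜ z) + C.mul (y ⊗ₜ z)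
      rw [TensorProduct.add_tmul, map_add]
    zero_mul := fun x => by
      change C.mul (0 ⊗ₜ x) = 0
      simp
    mul_zero := fun x => by
      change C.mul (x ⊗ₜ 0) = 0
      simp }

@[reducible] def toAlgOf (C : ColorHopfAlg k G H) : @Algebra k H _ (toRingOf C).toSemiring :=
  letI := toRingOf C
  Algebra.ofModule
    (fun r x y => by
      change C.mul ((r • x) ⊗ₜ y) = r • C.mul (x ⊗ₜ y)
      rw [← TensorProduct.smul_tmul', map_smul])
    (fun r x y => by
      change C.mul (x ⊗ₜ (r • y)) = r • C.mul (x ⊗ₜ y)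
      rw [TensorProduct.tmul_smul, map_smul])

lemma transfer (C : ColorHopfAlg k G H) (V W : Submodule k H) (hV : C.IsCHSub V)
    (hW : C.IsCHSub W) :
    (∀ x ∈ V, ∀ y ∈ W,
      C.comul (C.commMap (x ⊗ₜ[k] y)) =
        (TensorProduct.map C.commMap C.commMap) (C.comul2 (x ⊗ₜ[k] y))) ∧
    (∀ z ∈ C.commSub V W,
      C.comul z ∈ LinearMap.range
        (TensorProduct.map (C.commSub V W).subtype (C.commSub V W).subtype)) :=
  @ringForm k G H _ _ (toRingOf C) (toAlgOf C) C (fun _ _ => rfl) rfl V W hV hW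

end Transfer

section Statements

variable {H : Type*} [AddCommGroup H] [Module k H]

/-- for normal color Hopf subalgebras `X = V`, `Y = W` of `A`, the
commutator subalgebra `[X,Y]` is a graded subcoalgebra; explicitly
`Δ([x,y]) = φ(|x₂|,|y₁|) [x₁,y₁] ⊗ [x₂,y₂]`. -/
theorem commutator_subcoalgebra (C : ColorHopfAlg k G H)
    (V W : Submodule k H) (hV : C.IsCHSub V) (hW : C.IsCHSub W)
    (hVn : C.IsNormal V) (hWn : C.IsNormal W) :
    (∀ x ∈ V, ∀ y ∈ W,
      C.comul (C.commMap (x ⊗ₜ[k] y)) =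
        (TensorProduct.map C.commMap C.commMap) (C.comul2 (x ⊗ₜ[k] y))) ∧
    (∀ z ∈ C.commSub V W,
      C.comul z ∈ LinearMap.range
        (TensorProduct.map (C.commSub V W).subtype (C.commSub V W).subtype)) := by
  exact transfer C V W hV hW

end Statements

end ColorHopfPaper
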